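/- arXiv:2312.10442 — 2 statements merged into one kernel-verified Lean document; each statement's English description precedes it below -/
import Mathlib

section
/- Let (A, σ, f) be an F-algebra with quadratic pair that is a quadratic extension of an F-algebra with K/F-unitary involution (C, σ_C). If (C, σ_C) is isotropic, then (A, σ, f) is isotropic; if (C, σ_C) is hyperbolic, then (A, σ, f) is hyperbolic. -/
/-!  Common definitions for formalizing results of
"Triality over fields with I³ = 0" (F. K. Bingöl, A. Quéguiner-Mathieu).

We model an algebra with quadratic pair `(A, σ, f)` by the data of the reduced trace
`T` of `A` (given together with the property `IsReducedTrace` characterising it via a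
splitting field), the involution `σ`, and an element `ℓ ∈ A` with `ℓ + σ(ℓ) = 1`; the
semi-trace is `f = f_ℓ : s ↦ T(ℓ s)`.  By [KMRT, (5.7)] every semi-trace is of this
form, so this is an equivalent description of quadratic pairs.  -/

open scoped TensorProduct
open Module

noncomputable section

namespace Triality

variable (F : Type) [CommRing F]

/-- A (finite-dimensional) central simple algebra. -/
def IsCSA (A : Type) [Ring A] [Algebra F A] : Prop :=
  Algebra.IsCentral F A ∧ IsSimpleRing A ∧ Module.Finite F A

/-- The degree of a central simple algebra: the square root of its dimension. -/
def deg (A : Type) [Ring A] [Algebra F A] : ℕ := Nat.sqrt (Module.finrank F A)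

/-- Brauer equivalence of two algebras. -/
def BrauerEquiv (A B : Type) [Ring A] [Algebra F A] [Ring B] [Algebra F B] : Prop :=
  ∃ n m : ℕ, 0 < n ∧ 0 < m ∧
    Nonempty (Matrix (Fin n) (Fin n) A ≃ₐ[F] Matrix (Fin m) (Fin m) B)

/-- An algebra is split if it is isomorphic to a matrix algebra over the base. -/
def IsSplit (A : Type) [Ring A] [Algebra F A] : Prop :=
  ∃ n : ℕ, 0 < n ∧ Nonempty (A ≃ₐ[F] Matrix (Fin n) (Fin n) F)

/-- The Schur index of a central simple algebra: the smallest degree of a central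
simple algebra in its Brauer class (realised by the underlying division algebra). -/
def schurIndex (A : Type) [Ring A] [Algebra F A] : ℕ :=
  sInf { d : ℕ | 0 < d ∧ ∃ (D : Type) (_ : Ring D) (_ : Algebra F D),
    IsCSA F D ∧ Module.finrank F D = d * d ∧ BrauerEquiv F A D }

/-- A linear involution (anti-automorphism of period 2) on an algebra. -/
def IsInvolution {A : Type} [Ring A] [Algebra F A] (σ : A →ₗ[F] A) : Prop :=
  (∀ x y : A, σ (x * y) = σ y * σ x) ∧ (∀ x : A, σ (σ x) = x)

/-- `T` is the reduced trace of the central simple algebra `A`: over some splitting field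
it is given by the trace of matrices. -/
def IsReducedTrace (A : Type) [Ring A] [Algebra F A] (T : A →ₗ[F] F) : Prop :=
  ∃ (E : Type) (_ : Field E) (_ : Algebra F E) (n : ℕ)
    (e : E ⊗[F] A ≃ₐ[E] Matrix (Fin n) (Fin n) E),
    ∀ a : A, algebraMap F E (T a) = Matrix.trace (e ((1 : E) ⊗ₜ[F] a))

/-- The submodule of symmetric elements of an involution. -/
def symSet {A : Type} [Ring A] [Algebra F A] (σ : A →ₗ[F] A) : Submodule F A :=
  LinearMap.ker (σ - LinearMap.id)

/-- A quadratic pair on a central simple algebra `A` with reduced trace `T`, encoded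
by the involution `σ` together with an element `ℓ` with `ℓ + σ(ℓ) = 1`; the semi-trace of
the pair is `f_ℓ : s ↦ T(ℓ s)` on symmetric elements. -/
def IsQuadraticPair (A : Type) [Ring A] [Algebra F A] (T : A →ₗ[F] F)
    (σ : A →ₗ[F] A) (ℓ : A) : Prop :=
  IsInvolution F σ ∧
  2 * Module.finrank F (symSet F σ) = deg F A * (deg F A + 1) ∧
  (∀ x : A, σ x = -x → T x = 0) ∧
  ℓ + σ ℓ = 1

/-- A right ideal of `A`, as a submodule over the base. -/
def IsRightIdeal (A : Type) [Ring A] [Algebra F A] (I : Submodule F A) : Prop :=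
  ∀ x ∈ I, ∀ a : A, x * a ∈ I

/-- An isotropic right ideal for the quadratic pair `(σ, f_ℓ)`:
`σ(I)·I = 0` and the semi-trace `f_ℓ = T(ℓ·)` vanishes on `I ∩ Sym(A,σ)`. -/
def IsIsotropicIdeal (A : Type) [Ring A] [Algebra F A] (T : A →ₗ[F] F)
    (σ : A →ₗ[F] A) (ℓ : A) (I : Submodule F A) : Prop :=
  IsRightIdeal F A I ∧
  (∀ x ∈ I, ∀ y ∈ I, σ x * y = 0) ∧
  (∀ x ∈ I, σ x = x → T (ℓ * x) = 0)

/-- The algebra with quadratic pair `(A, σ, f_ℓ)` is isotropic. -/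
def QPIsotropic (A : Type) [Ring A] [Algebra F A] (T : A →ₗ[F] F)
    (σ : A →ₗ[F] A) (ℓ : A) : Prop :=
  ∃ I : Submodule F A, IsIsotropicIdeal F A T σ ℓ I ∧ I ≠ ⊥

/-- The algebra with quadratic pair `(A, σ, f_ℓ)` is hyperbolic. -/
def QPHyperbolic (A : Type) [Ring A] [Algebra F A] (T : A →ₗ[F] F)
    (σ : A →ₗ[F] A) (ℓ : A) : Prop :=
  ∃ I : Submodule F A, IsIsotropicIdeal F A T σ ℓ I ∧
    2 * Module.finrank F I = Module.finrank F A

/-- The index of an algebra with quadratic pair: the set of reduced dimensions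
`dim_F I / deg A` of isotropic right ideals `I`. -/
def qpIndexSet (A : Type) [Ring A] [Algebra F A] (T : A →ₗ[F] F)
    (σ : A →ₗ[F] A) (ℓ : A) : Set ℕ :=
  { r : ℕ | ∃ I : Submodule F A, IsIsotropicIdeal F A T σ ℓ I ∧
      Module.finrank F I = r * deg F A }

/-- A symplectic involution, characterised characteristic-freely: in characteristic 2,
`1` is an alternating element; in characteristic `≠ 2`, the symmetric elements have
dimension `n(n-1)/2`. -/
def IsSymplectic (A : Type) [Ring A] [Algebra F A] (σ : A →ₗ[F] A) : Prop :=
  IsInvolution F σ ∧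
    ((ringChar F = 2 ∧ ∃ y : A, 1 = y + σ y) ∨
     (ringChar F ≠ 2 ∧ 2 * Module.finrank F (symSet F σ) = deg F A * (deg F A - 1)))

/-- The sandwich map `Sand : A ⊗ A → End_F(A)`, `Sand(a ⊗ b)(x) = a x b`. -/
def sand (A : Type) [Ring A] [Algebra F A] : A ⊗[F] A →ₗ[F] A →ₗ[F] A :=
  TensorProduct.lift
    (LinearMap.mk₂ F (fun a b => (LinearMap.mulRight F b).comp (LinearMap.mulLeft F a))
      (fun a a' b => by ext x; simp [add_mul])
      (fun c a b => by ext x; simp [smul_mul_assoc])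
      (fun a b b' => by ext x; simp [mul_add])
      (fun c a b => by ext x; simp [mul_smul_comm]))

/-- The degree-two part map `A ⊗ A → T(A)`, `a ⊗ b ↦ ι a * ι b`. -/
def mu2 (A : Type) [Ring A] [Algebra F A] : A ⊗[F] A →ₗ[F] TensorAlgebra F A :=
  TensorProduct.lift
    (LinearMap.mk₂ F (fun a b => TensorAlgebra.ι F a * TensorAlgebra.ι F b)
      (fun a a' b => by simp [add_mul])
      (fun c a b => by simp [smul_mul_assoc])
      (fun a b b' => by simp [mul_add])
      (fun c a b => by simp [mul_smul_comm]))

/-- The defining relations of the Clifford algebra `C(A, σ, f)` of an algebra with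
quadratic pair, following [KMRT, §8.B]: in the tensor algebra `T(A)`, a symmetric
element `s`, viewed in degree one, is identified with the scalar `f(s) = T(ℓ s)`, and a
`σ₂`-symmetric element `c ∈ A ⊗ A` (i.e. `Sand(c) ∘ σ = Sand(c)`), viewed in degree two,
is identified with the degree-one element `Sand(c)(ℓ)`.  (In the split case
`A = End(V)`, `(σ, f) = ad(q)`, these are the Bichsel–Knus relations presenting
the even Clifford algebra `C₀(q)`.) -/
inductive CliffordRel (A : Type) [Ring A] [Algebra F A] (T : A →ₗ[F] F)
    (σ : A →ₗ[F] A) (ℓ : A) : TensorAlgebra F A → TensorAlgebra F A → Prop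
  | sym (s : A) (hs : σ s = s) :
      CliffordRel A T σ ℓ (TensorAlgebra.ι F s) (algebraMap F _ (T (ℓ * s)))
  | deg2 (c : A ⊗[F] A) (hc : ∀ x : A, sand F A c (σ x) = sand F A c x) :
      CliffordRel A T σ ℓ (mu2 F A c) (TensorAlgebra.ι F (sand F A c ℓ))

/-- The Clifford algebra of an algebra with quadratic pair [KMRT, §8.B]. -/
def CliffordAlg (A : Type) [Ring A] [Algebra F A] (T : A →ₗ[F] F)
    (σ : A →ₗ[F] A) (ℓ : A) : Type :=
  RingQuot (CliffordRel F A T σ ℓ)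

instance (A : Type) [Ring A] [Algebra F A] (T : A →ₗ[F] F) (σ : A →ₗ[F] A) (ℓ : A) :
    Ring (CliffordAlg F A T σ ℓ) := inferInstanceAs (Ring (RingQuot _))

instance (A : Type) [Ring A] [Algebra F A] (T : A →ₗ[F] F) (σ : A →ₗ[F] A) (ℓ : A) :
    Algebra F (CliffordAlg F A T σ ℓ) := inferInstanceAs (Algebra F (RingQuot _))

/-- The canonical image of `a ∈ A` as a degree-one element of the Clifford algebra. -/
def cliffGen (A : Type) [Ring A] [Algebra F A] (T : A →ₗ[F] F)
    (σ : A →ₗ[F] A) (ℓ : A) (a : A) : CliffordAlg F A T σ ℓ :=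
  RingQuot.mkAlgHom F (CliffordRel F A T σ ℓ) (TensorAlgebra.ι F a)

/-- The quadratic pair `(σ, f)` has trivial discriminant: the centre of its Clifford
algebra is the split étale quadratic algebra, i.e. contains a nontrivial idempotent. -/
def HasTrivialDiscriminant (A : Type) [Ring A] [Algebra F A] (T : A →ₗ[F] F)
    (σ : A →ₗ[F] A) (ℓ : A) : Prop :=
  ∃ e : CliffordAlg F A T σ ℓ, e ∈ Subalgebra.center F (CliffordAlg F A T σ ℓ) ∧
    e * e = e ∧ e ≠ 0 ∧ e ≠ 1

/-- `(A, σ)` (an algebra with involution) is a quadratic extension of the algebra with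
unitary involution `(C, σ_C)`, where `uC` is a distinguished generator of the centre `K`
of `C` over `F`:  `C` embeds in `A` compatibly with the involutions, with image the
centralizer of the image of `K`. -/
def IsInvQuadExt (A : Type) [Ring A] [Algebra F A] (σ : A →ₗ[F] A)
    (C : Type) [Ring C] [Algebra F C] (σC : C →ₗ[F] C) (uC : C) : Prop :=
  ∃ j : C →ₐ[F] A, Function.Injective j ∧ (∀ x : C, σ (j x) = j (σC x)) ∧
    (Set.range (j : C → A) = Set.centralizer {j uC})

/-- `(A, σ, f_ℓ)` (an algebra with quadratic pair) is a quadratic extension of the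
algebra with unitary involution `(C, σ_C)`:  in addition to the conditions of
`IsInvQuadExt`, the semi-trace `f_ℓ` coincides on symmetric elements with `f_{ℓK}` for
some generator `ℓK` of the quadratic étale algebra `K = F[j(uC)] ⊆ A` with
`ℓK² - ℓK ∈ F`. -/
def IsQPQuadExt (A : Type) [Ring A] [Algebra F A] (T : A →ₗ[F] F)
    (σ : A →ₗ[F] A) (ℓ : A)
    (C : Type) [Ring C] [Algebra F C] (σC : C →ₗ[F] C) (uC : C) : Prop :=
  ∃ j : C →ₐ[F] A, Function.Injective j ∧ (∀ x : C, σ (j x) = j (σC x)) ∧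
    (Set.range (j : C → A) = Set.centralizer {j uC}) ∧
    ∃ ℓK ∈ Algebra.adjoin F ({j uC} : Set A),
      ℓK ∉ Set.range (algebraMap F A) ∧
      (ℓK * ℓK - ℓK) ∈ Set.range (algebraMap F A) ∧
      ∀ s : A, σ s = s → T (ℓ * s) = T (ℓK * s)

/-- The algebra with unitary involution `(C, σ_C)` is isotropic: there is a nonzero
right ideal `J` with `σ_C(J)·J = 0`. -/
def UnitaryIsotropic (C : Type) [Ring C] [Algebra F C] (σC : C →ₗ[F] C) : Prop :=
  ∃ J : Submodule F C, IsRightIdeal F C J ∧ (∀ x ∈ J, ∀ y ∈ J, σC x * y = 0) ∧ J ≠ ⊥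

/-- The algebra with unitary involution `(C, σ_C)` is hyperbolic: there is a right
ideal `J` with `σ_C(J)·J = 0` of half the dimension (over `F`; equivalently, of half the
dimension over the centre). -/
def UnitaryHyperbolic (C : Type) [Ring C] [Algebra F C] (σC : C →ₗ[F] C) : Prop :=
  ∃ J : Submodule F C, IsRightIdeal F C J ∧ (∀ x ∈ J, ∀ y ∈ J, σC x * y = 0) ∧
    2 * Module.finrank F J = Module.finrank F C

/-- The 3-fold quadratic Pfister form `⟨⟨a, b, c]]` on `F⁸`. -/
def pfister3Form (a b c : F) : (Fin 8 → F) → F := fun v =>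
  (v 0 * v 0 + v 0 * v 1 + c * (v 1 * v 1))
  + a * (v 2 * v 2 + v 2 * v 3 + c * (v 3 * v 3))
  + b * (v 4 * v 4 + v 4 * v 5 + c * (v 5 * v 5))
  + a * b * (v 6 * v 6 + v 6 * v 7 + c * (v 7 * v 7))

/-- `I_q³ F = 0`: every 3-fold quadratic Pfister form over `F` is hyperbolic, i.e.
vanishes on a totally isotropic subspace of half the dimension. -/
def I3Trivial : Prop :=
  ∀ a b c : F, a ≠ 0 → b ≠ 0 → (1 : F) - 4 * c ≠ 0 →
    ∃ W : Submodule F (Fin 8 → F), Module.finrank F W = 4 ∧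
      ∀ v ∈ W, pfister3Form F a b c v = 0

/-- An algebra with quadratic pair, bundled. -/
structure QPAlgebra : Type 1 where
  A : Type
  [ring : Ring A]
  [alg : Algebra F A]
  T : A →ₗ[F] F
  σ : A →ₗ[F] A
  ℓ : A
  csa : IsCSA F A
  trd : IsReducedTrace F A T
  pair : IsQuadraticPair F A T σ ℓ

attribute [instance] QPAlgebra.ring QPAlgebra.alg

/-- A trialitarian triple: three degree-8 algebras with quadratic pair such that the
Clifford algebra of the first, with its canonical quadratic pair, is isomorphic to the
product of the other two.  The isomorphism intertwines the canonical involution of the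
Clifford algebra (which maps the degree-one generator attached to `a` to the one
attached to `σ(a)`) with the product involution; since the degree-one elements generate
the Clifford algebra, this is recorded on generators. -/
def IsTrialitarianTriple (X Y Z : QPAlgebra F) : Prop :=
  Module.finrank F X.A = 64 ∧ Module.finrank F Y.A = 64 ∧ Module.finrank F Z.A = 64 ∧
  ∃ φ : CliffordAlg F X.A X.T X.σ X.ℓ ≃ₐ[F] (Y.A × Z.A),
    ∀ a : X.A,
      φ (cliffGen F X.A X.T X.σ X.ℓ (X.σ a)) =
        (Y.σ (φ (cliffGen F X.A X.T X.σ X.ℓ a)).1,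
         Z.σ (φ (cliffGen F X.A X.T X.σ X.ℓ a)).2)

/-- A trialitarian triple is isotropic if one of its three members is isotropic
(equivalently, by triality, each of them is). -/
def TripleIsotropic (X Y Z : QPAlgebra F) : Prop :=
  QPIsotropic F X.A X.T X.σ X.ℓ ∨ QPIsotropic F Y.A Y.T Y.σ Y.ℓ ∨
    QPIsotropic F Z.A Z.T Z.σ Z.ℓ

/-- The (unordered) triple of Schur indices of a trialitarian triple; the index
`ind T = (a, b, c)` with `a ≤ b ≤ c` of the paper corresponds to this multiset being
`{a, b, c}`. -/
def indexMultiset (X Y Z : QPAlgebra F) : Multiset ℕ :=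
  {schurIndex F X.A, schurIndex F Y.A, schurIndex F Z.A}

/-- The relations of the quaternion algebra `[a, b)_F = F⟨i, j⟩` with
`i² - i = a`, `j² = b`, `ji = (1 - i)j`. -/
inductive QuatRel (a b : F) : FreeAlgebra F (Fin 2) → FreeAlgebra F (Fin 2) → Prop
  | ii : QuatRel a b (FreeAlgebra.ι F 0 * FreeAlgebra.ι F 0)
      (FreeAlgebra.ι F 0 + algebraMap F _ a)
  | jj : QuatRel a b (FreeAlgebra.ι F 1 * FreeAlgebra.ι F 1) (algebraMap F _ b)
  | ji : QuatRel a b (FreeAlgebra.ι F 1 * FreeAlgebra.ι F 0)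
      ((1 - FreeAlgebra.ι F 0) * FreeAlgebra.ι F 1)

/-- The quaternion algebra `[a, b)_F`, presented by generators and relations. -/
def QuatAlg (a b : F) : Type := RingQuot (QuatRel F a b)

instance (a b : F) : Ring (QuatAlg F a b) := inferInstanceAs (Ring (RingQuot _))
instance (a b : F) : Algebra F (QuatAlg F a b) := inferInstanceAs (Algebra F (RingQuot _))

/-- A ring in which every nonzero element is invertible. -/
def IsDivision (A : Type) [Ring A] : Prop := ∀ x : A, x ≠ 0 → IsUnit x

end Triality

end

namespace Triality

section TraceForms

variable {F R : Type} [Field F] [Ring R] [Algebra F R]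

theorem IsReducedTrace.map_mul_comm {T : R →ₗ[F] F} (hT : IsReducedTrace F R T) (x y : R) :
    T (x * y) = T (y * x) := by
  obtain ⟨E, _, _, n, e, he⟩ := hT
  have key (u v : R) : (1 : E) ⊗ₜ[F] (u * v) = ((1 : E) ⊗ₜ[F] u) * ((1 : E) ⊗ₜ[F] v) := by
    simp
  apply (algebraMap F E).injective
  rw [he, he, key, key, map_mul, map_mul, Matrix.trace_mul_comm]

theorem IsReducedTrace.ne_zero [Nontrivial R] {T : R →ₗ[F] F} (hT : IsReducedTrace F R T) :
    T ≠ 0 := by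
  obtain ⟨E, _, _, n, e, he⟩ := hT
  rintro rfl
  have htr (z : E ⊗[F] R) : Matrix.trace (e z) = 0 := by
    induction z using TensorProduct.induction_on with
    | zero => simp
    | add x y hx hy => simp [hx, hy]
    | tmul c a =>
      have h : c ⊗ₜ[F] a = c • ((1 : E) ⊗ₜ[F] a) := by simp [TensorProduct.smul_tmul']
      rw [h, map_smul, Matrix.trace_smul, ← he]
      simp
  have : Nontrivial (E ⊗[F] R) :=
    (Algebra.TensorProduct.includeRight_injective (R := F) (A := E) (B := R)
      (algebraMap F E).injective).nontrivial
  have : Nontrivial (Matrix (Fin n) (Fin n) E) := e.injective.nontrivial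
  rcases n with _ | n
  · exact not_subsingleton (Matrix (Fin 0) (Fin 0) E) inferInstance
  · have h := htr (e.symm (Matrix.single 0 0 1))
    simp at h

/-- A nonzero trace on a simple ring has a nondegenerate trace form. -/
theorem eq_zero_of_forall_trace_mul_eq_zero [IsSimpleRing R] {T : R →ₗ[F] F} (hT : T ≠ 0)
    (hcomm : ∀ x y, T (x * y) = T (y * x)) {x : R} (hx : ∀ y, T (x * y) = 0) : x = 0 := by
  let I : TwoSidedIdeal R := TwoSidedIdeal.mk' {x | ∀ y, T (x * y) = 0}
    (by simp)
    (by intro a b ha hb y; simp [add_mul, ha y, hb y])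
    (by intro a ha y; simp [ha y])
    (by intro a b hb y; rw [mul_assoc, hcomm, mul_assoc]; exact hb _)
    (by intro a b ha y; rw [mul_assoc]; exact ha _)
  have hmem (z : R) : z ∈ I ↔ ∀ y, T (z * y) = 0 := by
    simp [I, TwoSidedIdeal.mem_mk']
  rcases eq_bot_or_eq_top I with h | h
  · exact (TwoSidedIdeal.mem_bot R).1 (h ▸ (hmem x).2 hx)
  · refine absurd (LinearMap.ext fun y => ?_) hT
    have h1 : (1 : R) ∈ I := h ▸ TwoSidedIdeal.mem_top R
    simpa using (hmem 1).1 h1 y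

theorem finrank_range_mulLeft_eq_mulRight [Module.Finite F R] {τ : R →ₗ[F] F}
    (hnd : ∀ x, (∀ y, τ (x * y) = 0) → x = 0) (e : R) :
    finrank F (LinearMap.mulLeft F e).range = finrank F (LinearMap.mulRight F e).range := by
  let B : R →ₗ[F] Dual F R := (LinearMap.mul F R).compr₂ τ
  have hB : Function.Injective B := by
    rw [injective_iff_map_eq_zero]
    intro x hx
    exact hnd x fun y => by simpa [B] using LinearMap.congr_fun hx y
  let B' : R ≃ₗ[F] Dual F R := LinearEquiv.ofInjectiveOfFinrankEq B hB
    (Subspace.dual_finrank_eq).symm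
  have hadj : (LinearMap.mulLeft F e).dualMap ∘ₗ (B' : R →ₗ[F] Dual F R)
      = (B' : R →ₗ[F] Dual F R) ∘ₗ LinearMap.mulRight F e := by
    ext x y
    simp [B', B, mul_assoc]
  rw [← LinearMap.finrank_range_dualMap_eq_finrank_range (LinearMap.mulLeft F e),
    ← LinearEquiv.range_comp B' (LinearMap.mulLeft F e).dualMap, hadj, LinearMap.range_comp,
    LinearEquiv.finrank_map_eq]

theorem IsInvolution.finrank_ker_mulLeft [Module.Finite F R] {σ : R →ₗ[F] R}
    (hσ : IsInvolution F σ) {t : R →ₗ[F] F}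
    (hnd : ∀ x, (∀ y, t (x * y) = 0) → x = 0) (e : R) :
    finrank F (LinearMap.mulLeft F e).range + finrank F (LinearMap.mulLeft F (σ e)).ker
      = finrank F R := by
  let S : R ≃ₗ[F] R := LinearEquiv.ofInvolutive σ hσ.2
  have h : LinearMap.mulLeft F (σ e) ∘ₗ (S : R →ₗ[F] R)
      = (S : R →ₗ[F] R) ∘ₗ LinearMap.mulRight F e := by
    ext x
    exact (hσ.1 x e).symm
  have h2 : finrank F (LinearMap.mulLeft F (σ e)).range
      = finrank F (LinearMap.mulRight F e).range := by
    rw [← LinearEquiv.range_comp S (LinearMap.mulLeft F (σ e)), h, LinearMap.range_comp,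
      LinearEquiv.finrank_map_eq]
  rw [finrank_range_mulLeft_eq_mulRight hnd, ← h2]
  exact LinearMap.finrank_range_add_finrank_ker _

/-- In a semisimple ring with involution, right ideals are generated by idempotents. -/
theorem IsRightIdeal.exists_idempotent [IsSemisimpleRing R] {σ : R →ₗ[F] R}
    (hσ : IsInvolution F σ) {J : Submodule F R} (hJ : IsRightIdeal F R J) :
    ∃ e ∈ J, e * e = e ∧ J = (LinearMap.mulLeft F e).range := by
  let L : Ideal R :=
    { carrier := {x | σ x ∈ J}
      zero_mem' := by simp
      add_mem' := by intro a b ha hb; simpa using J.add_mem ha hb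
      smul_mem' := by
        intro c x hx
        simpa [hσ.1] using hJ _ hx (σ c) }
  have hL (x : R) : x ∈ L ↔ σ x ∈ J := Iff.rfl
  obtain ⟨g, hg, hLg⟩ := IsSemisimpleRing.ideal_eq_span_idempotent L
  have hgJ : σ g ∈ J := by
    rw [← hL, hLg]
    exact Ideal.mem_span_singleton_self g
  refine ⟨σ g, hgJ, by rw [← hσ.1, hg.eq], le_antisymm (fun x hx => ?_) ?_⟩
  · have hx' : σ x ∈ L := by rwa [hL, hσ.2]
    rw [hLg, Ideal.mem_span_singleton'] at hx'
    obtain ⟨c, hc⟩ := hx'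
    exact ⟨σ c, by rw [LinearMap.mulLeft_apply, ← hσ.1, hc, hσ.2]⟩
  · rintro _ ⟨x, rfl⟩
    exact hJ _ hgJ x

/-- If `u ^ 2 = u + a` with `1 + 4 a ≠ 0`, a trace form which is nondegenerate on the whole
algebra remains nondegenerate on the centralizer of `u`. -/
theorem eq_zero_of_forall_centralizer_trace_mul_eq_zero {T : R →ₗ[F] F}
    (hcomm : ∀ x y, T (x * y) = T (y * x))
    (hnd : ∀ x, (∀ y, T (x * y) = 0) → x = 0)
    {u : R} {a : F} (hu : u * u = u + algebraMap F R a) (ha : (1 : F) + 4 * a ≠ 0)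
    {c : R} (hc : u * c = c * u)
    (h : ∀ y ∈ Set.centralizer {u}, T (c * y) = 0) : c = 0 := by
  refine hnd c fun y => ?_
  rw [Algebra.algebraMap_eq_smul_one] at hu
  have hu' (z : R) : u * (u * z) = u * z + a • z := by
    rw [← mul_assoc, hu, add_mul, smul_one_mul]
  have hmem : (2 : F) • (u * y * u) - u * y - y * u + (1 + 2 * a) • y
      ∈ Set.centralizer {u} := by
    rw [Set.mem_centralizer_iff]
    rintro _ rfl
    simp only [mul_add, mul_sub, add_mul, sub_mul, mul_smul_comm, smul_mul_assoc, mul_assoc,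
      hu', hu, mul_one]
    module
  have h1 : T (c * (u * y * u)) = T (c * (u * y)) + a * T (c * y) := by
    rw [← mul_assoc, hcomm, ← mul_assoc, hc, mul_assoc, hu', mul_add, map_add, mul_smul_comm,
      map_smul, smul_eq_mul]
  have h2 : T (c * (y * u)) = T (c * (u * y)) := by
    rw [← mul_assoc, hcomm, ← mul_assoc, hc, mul_assoc]
  have h3 := h _ hmem
  simp only [mul_add, mul_sub, mul_smul_comm, map_add, map_sub, map_smul, smul_eq_mul, h1,
    h2] at h3
  refine (mul_eq_zero.1 ?_).resolve_left ha
  linear_combination h3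

/-- The right ideal generated by an idempotent `e` with `σ(e) e = 0` is isotropic as soon as the
semi-trace is given by an element commuting with `σ(e)`. -/
theorem isIsotropicIdeal_range_mulLeft {T : R →ₗ[F] F} {σ : R →ₗ[F] R} (hσ : IsInvolution F σ)
    (hcomm : ∀ x y, T (x * y) = T (y * x)) {ℓ m e : R}
    (hm : ∀ s, σ s = s → T (ℓ * s) = T (m * s)) (he : e * e = e) (hσe : σ e * e = 0)
    (hme : Commute m (σ e)) :
    IsIsotropicIdeal F R T σ ℓ (LinearMap.mulLeft F e).range := by
  refine ⟨?_, ?_, ?_⟩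
  · rintro _ ⟨x, rfl⟩ b
    exact ⟨x * b, by simp [mul_assoc]⟩
  · rintro _ ⟨x, rfl⟩ _ ⟨y, rfl⟩
    simp only [LinearMap.mulLeft_apply, hσ.1]
    rw [mul_assoc, ← mul_assoc (σ e), hσe, zero_mul, mul_zero]
  · rintro s ⟨x, hx⟩ hs
    rw [LinearMap.mulLeft_apply] at hx
    have h1 : e * s = s := by rw [← hx, ← mul_assoc, he]
    have h2 : s * σ e = s := by
      conv_rhs => rw [← hs, ← h1, hσ.1, hs]
    rw [hm s hs, ← h2, ← mul_assoc, hcomm, ← mul_assoc, ← hme.eq, mul_assoc, ← h1,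
      ← mul_assoc (σ e), hσe, zero_mul, mul_zero, map_zero]

end TraceForms

/-- Proposition 3.5 of the paper.  Let `(A, σ, f)` be an `F`-algebra
with quadratic pair that is a quadratic extension of an `F`-algebra with `K/F`-unitary
involution `(C, σ_C)` (where `uC` generates the centre `K = F[uC]` of `C`).  If
`(C, σ_C)` is isotropic then `(A, σ, f)` is isotropic; if `(C, σ_C)` is hyperbolic
then `(A, σ, f)` is hyperbolic. -/
theorem quad_ext_isotropic_hyperbolic (F : Type) [Field F]
    (A : Type) [Ring A] [Algebra F A] (hA : IsCSA F A)
    (T : A →ₗ[F] F) (hT : IsReducedTrace F A T)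
    (σ : A →ₗ[F] A) (ℓ : A) (hqp : IsQuadraticPair F A T σ ℓ)
    -- (C, σ_C): an algebra with K/F-unitary involution, K = F[uC] its étale quadratic centre
    (C : Type) [Ring C] [Algebra F C]
    (hCfin : Module.Finite F C) (hCss : IsSemisimpleRing C)
    (σC : C →ₗ[F] C) (hσC : IsInvolution F σC)
    (uC : C) (a : F) (huC : uC * uC = uC + algebraMap F C a)
    (ha : (1 : F) + 4 * a ≠ 0) (hgen : uC ∉ Set.range (algebraMap F C))
    (hcenter : Subalgebra.center F C = Algebra.adjoin F ({uC} : Set C))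
    (hunit : σC uC = 1 - uC)
    -- (A, σ, f) is a quadratic extension of (C, σ_C)
    (hext : IsQPQuadExt F A T σ ℓ C σC uC) :
    (UnitaryIsotropic F C σC → QPIsotropic F A T σ ℓ) ∧
    (UnitaryHyperbolic F C σC → QPHyperbolic F A T σ ℓ) := by
  obtain ⟨j, hj, hjσ, hjr, ℓK, hℓK, -, -, hf⟩ := hext
  obtain ⟨-, hsimple, hfin⟩ := hA
  have hσ := hqp.1
  have hcomm := hT.map_mul_comm
  have hnd (x : A) (hx : ∀ y, T (x * y) = 0) : x = 0 :=
    eq_zero_of_forall_trace_mul_eq_zero hT.ne_zero hcomm hx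
  have hju (c : C) : j uC * j c = j c * j uC := by
    have h : j c ∈ Set.centralizer {j uC} := hjr ▸ ⟨c, rfl⟩
    exact Set.mem_centralizer_iff.1 h _ rfl
  have hcommK (c : C) : Commute ℓK (j c) :=
    Algebra.commute_of_mem_adjoin_singleton_of_commute hℓK (hju c).symm |>.symm
  have hiso {e : C} (he : e * e = e) (hσe : σC e * e = 0) :
      IsIsotropicIdeal F A T σ ℓ (LinearMap.mulLeft F (j e)).range :=
    isIsotropicIdeal_range_mulLeft hσ hcomm hf (by rw [← map_mul, he])
      (by rw [hjσ, ← map_mul, hσe, map_zero]) (by rw [hjσ]; exact hcommK _)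
  constructor
  · rintro ⟨J, hJ, hJJ, hJ0⟩
    obtain ⟨e, heJ, he, rfl⟩ := hJ.exists_idempotent hσC
    refine ⟨_, hiso he (hJJ e heJ e heJ), fun hbot => hJ0 ?_⟩
    have h0 : j e ∈ (LinearMap.mulLeft F (j e)).range := ⟨1, by simp⟩
    rw [hbot, Submodule.mem_bot, map_eq_zero_iff j hj] at h0
    simp [h0]
  · rintro ⟨J, hJ, hJJ, hdim⟩
    obtain ⟨e, heJ, he, rfl⟩ := hJ.exists_idempotent hσC
    have hσe := hJJ e heJ e heJ
    refine ⟨_, hiso he hσe, ?_⟩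
    have hC := hσC.finrank_ker_mulLeft (t := T ∘ₗ j.toLinearMap)
      (fun c hc => by
        refine (map_eq_zero_iff j hj).1 (eq_zero_of_forall_centralizer_trace_mul_eq_zero hcomm hnd
          (u := j uC) (a := a) ?_ ha (hju c) ?_)
        · rw [← map_mul, huC, map_add, AlgHom.commutes]
        · rw [← hjr]
          rintro _ ⟨y, rfl⟩
          simpa using hc y) e
    have hle : (LinearMap.mulLeft F e).range ≤ (LinearMap.mulLeft F (σC e)).ker := by
      rintro _ ⟨x, rfl⟩
      simp [← mul_assoc, hσe]
    have heq := Submodule.eq_of_le_of_finrank_eq hle (by lia)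
    have hidem : σC e * σC e = σC e := by rw [← hσC.1, he]
    have hmem : 1 - σC e ∈ (LinearMap.mulLeft F e).range := by
      rw [heq]
      simp [mul_sub, hidem]
    obtain ⟨x, hx⟩ := hmem
    rw [LinearMap.mulLeft_apply] at hx
    have hA : (LinearMap.mulLeft F (j e)).range = (LinearMap.mulLeft F (σ (j e))).ker := by
      refine le_antisymm ?_ fun y hy => ⟨j x * y, ?_⟩
      · rintro _ ⟨y, rfl⟩
        simp [← mul_assoc, hjσ, ← map_mul, hσe]
      · rw [LinearMap.mem_ker, LinearMap.mulLeft_apply, hjσ] at hy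
        rw [LinearMap.mulLeft_apply, ← mul_assoc, ← map_mul, hx, map_sub, map_one, sub_mul, hy,
          one_mul, sub_zero]
    have hdimA := hσ.finrank_ker_mulLeft hnd (j e)
    rw [← hA] at hdimA
    lia

end Triality
end

section
/- Let (A, σ, f) be an F-algebra with quadratic pair which is a quadratic extension of an F-algebra with K/F-unitary involution (C, σ_C), and assume C has odd degree (so deg A ≡ 2 mod 4). Then the discriminant of (σ, f) coincides with the class defining the étale quadratic F-algebra K. -/
/-!  Common definitions for formalizing results of
"Triality over fields with I³ = 0" (F. K. Bingöl, A. Quéguiner-Mathieu).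

We model an algebra with quadratic pair `(A, σ, f)` by the data of the reduced trace
`T` of `A` (given together with the property `IsReducedTrace` characterising it via a
splitting field), the involution `σ`, and an element `ℓ ∈ A` with `ℓ + σ(ℓ) = 1`; the
semi-trace is `f = f_ℓ : s ↦ T(ℓ s)`.  By [KMRT, (5.7)] every semi-trace is of this
form, so this is an equivalent description of quadratic pairs.  -/

open scoped TensorProduct
open Module

noncomputable section

namespace Triality

open Matrix in
/-- A matrix model of the spin representation of the hyperbolic quadratic form of rank `2m`:
creation operators `x i` and annihilation operators `y i` acting on a space with a basis indexed
by `J`, graded by `par`, with vacuum `v₀` and full state `v₁`. -/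
structure FockModel (E : Type) [Field E] (m : ℕ) where
  J : Type
  [fintype : Fintype J]
  [decEq : DecidableEq J]
  par : J → ZMod 2
  v₀ : J
  v₁ : J
  x : Fin m → Matrix J J E
  y : Fin m → Matrix J J E
  card : Fintype.card J = 2 ^ m
  xx : ∀ i j, x i * x j + x j * x i = 0
  yy : ∀ i j, y i * y j + y j * y i = 0
  xy : ∀ i j, x i * y j + y j * x i = if i = j then 1 else 0
  x_sq : ∀ i, x i * x i = 0
  y_sq : ∀ i, y i * y i = 0
  x_odd : ∀ i j k, x i j k ≠ 0 → par j = par k + 1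
  y_odd : ∀ i j k, y i j k ≠ 0 → par j = par k + 1
  gen : ∀ S : Subalgebra E (Matrix J J E), (∀ i, x i ∈ S) → (∀ i, y i ∈ S) → S = ⊤
  vac : ∀ v : J → E, (∀ i, y i *ᵥ v = 0) ↔ ∀ j, j ≠ v₀ → v j = 0
  full : ∀ v : J → E, (∀ i, x i *ᵥ v = 0) ↔ ∀ j, j ≠ v₁ → v j = 0
  par_v₁ : par v₁ = par v₀ + m

attribute [instance] FockModel.fintype FockModel.decEq

open Matrix in
/-- The trivial Fock model in rank zero. -/
def FockModel.zero (E : Type) [Field E] : FockModel E 0 where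
  J := Unit
  par := 0
  v₀ := ()
  v₁ := ()
  x := Fin.elim0
  y := Fin.elim0
  card := by simp
  xx i := i.elim0
  yy i := i.elim0
  xy i := i.elim0
  x_sq i := i.elim0
  y_sq i := i.elim0
  x_odd i := i.elim0
  y_odd i := i.elim0
  gen S _ _ := by
    rw [eq_top_iff]
    intro X _
    have : X = algebraMap E _ (X () ()) := by
      ext i j
      simp [Matrix.algebraMap_matrix_apply]
    rw [this]
    exact S.algebraMap_mem _
  vac v := by simp
  full v := by simp
  par_v₁ := by simp

open Matrix in
/-- Adding one hyperbolic plane to a Fock model. -/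
def FockModel.succ {E : Type} [Field E] {m : ℕ} (M : FockModel E m) : FockModel E (m + 1) where
  J := M.J ⊕ M.J
  par := Sum.elim M.par (fun j => M.par j + 1)
  v₀ := Sum.inl M.v₀
  v₁ := Sum.inr M.v₁
  x := Fin.cons (fromBlocks 0 0 1 0) (fun i => fromBlocks (M.x i) 0 0 (-M.x i))
  y := Fin.cons (fromBlocks 0 1 0 0) (fun i => fromBlocks (M.y i) 0 0 (-M.y i))
  card := by simp [M.card, pow_succ]; ring
  xx i j := by
    refine Fin.cases ?_ (fun i => ?_) i <;> refine Fin.cases ?_ (fun j => ?_) j <;>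
      simp [fromBlocks_multiply, fromBlocks_add, M.xx, ← fromBlocks_zero]
  yy i j := by
    refine Fin.cases ?_ (fun i => ?_) i <;> refine Fin.cases ?_ (fun j => ?_) j <;>
      simp [fromBlocks_multiply, fromBlocks_add, M.yy, ← fromBlocks_zero]
  xy i j := by
    refine Fin.cases ?_ (fun i => ?_) i <;> refine Fin.cases ?_ (fun j => ?_) j
    · simp [fromBlocks_multiply, fromBlocks_add]
    · simp [fromBlocks_multiply, fromBlocks_add, (Fin.succ_ne_zero _).symm]
    · simp [fromBlocks_multiply, fromBlocks_add]
    · simp only [Fin.cons_succ, fromBlocks_multiply, fromBlocks_add, Fin.succ_inj]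
      simp only [mul_zero, add_zero, zero_mul, zero_add, mul_neg, neg_mul, neg_neg, M.xy]
      split_ifs <;> simp
  x_sq i := by
    refine Fin.cases ?_ (fun i => ?_) i <;> simp [fromBlocks_multiply, M.x_sq]
  y_sq i := by
    refine Fin.cases ?_ (fun i => ?_) i <;> simp [fromBlocks_multiply, M.y_sq]
  x_odd i j k := by
    refine Fin.cases ?_ (fun i => ?_) i
    · rcases j with j | j <;> rcases k with k | k <;> simp [Matrix.one_apply]
      rintro rfl; rfl
    · rcases j with j | j <;> rcases k with k | k <;> simp
      · exact M.x_odd i j k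
      · intro h; rw [M.x_odd i j k h]
  y_odd i j k := by
    refine Fin.cases ?_ (fun i => ?_) i
    · rcases j with j | j <;> rcases k with k | k <;> simp [Matrix.one_apply]
      rintro rfl
      rw [add_assoc, CharTwo.add_self_eq_zero, add_zero]
    · rcases j with j | j <;> rcases k with k | k <;> simp
      · exact M.y_odd i j k
      · intro h; rw [M.y_odd i j k h]
  gen S hx hy := by
    have x0 := hx 0
    have y0 := hy 0
    have p0 := S.mul_mem y0 x0
    have p1 := S.mul_mem x0 y0
    simp only [Fin.cons_zero, fromBlocks_multiply, mul_zero, add_zero, zero_add, mul_one] at x0 y0 p0 p1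
    let S' : Subalgebra E (Matrix M.J M.J E) :=
      { carrier := {X | fromBlocks X 0 0 0 ∈ S}
        mul_mem' := fun {a b} ha hb => by
          have := S.mul_mem ha hb
          simpa [fromBlocks_multiply] using this
        add_mem' := fun {a b} ha hb => by
          have := S.add_mem ha hb
          simpa [fromBlocks_add] using this
        algebraMap_mem' := fun r => by
          have := S.smul_mem p0 r
          simpa [fromBlocks_smul, Algebra.algebraMap_eq_smul_one] using this }
    have hS' : S' = ⊤ := by
      apply M.gen
      · intro i
        have := S.mul_mem (hx i.succ) p0
        change fromBlocks _ 0 0 0 ∈ S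
        simpa [fromBlocks_multiply] using this
      · intro i
        have := S.mul_mem (hy i.succ) p0
        change fromBlocks _ 0 0 0 ∈ S
        simpa [fromBlocks_multiply] using this
    have h00 : ∀ X : Matrix M.J M.J E, fromBlocks X 0 0 0 ∈ S := fun X => by
      have : X ∈ S' := hS' ▸ Algebra.mem_top
      exact this
    rw [eq_top_iff]
    intro X _
    rw [← fromBlocks_toBlocks X]
    have key : ∀ A B C D : Matrix M.J M.J E, fromBlocks A B C D =
        fromBlocks A 0 0 0 + fromBlocks B 0 0 0 * fromBlocks 0 1 0 0 +
        fromBlocks 0 0 1 0 * fromBlocks C 0 0 0 +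
        fromBlocks 0 0 1 0 * fromBlocks D 0 0 0 * fromBlocks 0 1 0 0 := by
      intro A B C D
      simp [fromBlocks_multiply, fromBlocks_add]
    rw [key]
    exact S.add_mem (S.add_mem (S.add_mem (h00 _) (S.mul_mem (h00 _) y0))
      (S.mul_mem x0 (h00 _))) (S.mul_mem (S.mul_mem x0 (h00 _)) y0)
  vac v := by
    have h := M.vac (v ∘ Sum.inl)
    simp only [Fin.forall_fin_succ, Fin.cons_zero, Fin.cons_succ, fromBlocks_mulVec, Sum.forall,
      ne_eq, Sum.inl.injEq, reduceCtorEq, not_false_eq_true, true_imp_iff]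
    constructor
    · rintro ⟨h0, h1⟩
      have h2 : ∀ j, v (Sum.inr j) = 0 := fun j => by
        simpa using congrFun h0 (Sum.inl j)
      refine ⟨h.1 fun i => ?_, h2⟩
      ext j
      simpa using congrFun (h1 i) (Sum.inl j)
    · rintro ⟨h0, h1⟩
      have h2 : v ∘ Sum.inr = 0 := funext h1
      refine ⟨?_, fun i => ?_⟩
      · ext (j | j) <;> simp [h2]
      · have := h.2 h0 i
        ext (j | j) <;> simp [h2, this]
  full v := by
    have h := M.full (v ∘ Sum.inr)
    simp only [Fin.forall_fin_succ, Fin.cons_zero, Fin.cons_succ, fromBlocks_mulVec, Sum.forall,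
      ne_eq, Sum.inr.injEq, reduceCtorEq, not_false_eq_true, true_imp_iff]
    constructor
    · rintro ⟨h0, h1⟩
      have h2 : ∀ j, v (Sum.inl j) = 0 := fun j => by
        simpa using congrFun h0 (Sum.inr j)
      refine ⟨h2, h.1 fun i => ?_⟩
      ext j
      simpa [neg_mulVec] using congrFun (h1 i) (Sum.inr j)
    · rintro ⟨h1, h0⟩
      have h2 : v ∘ Sum.inl = 0 := funext h1
      refine ⟨?_, fun i => ?_⟩
      · ext (j | j) <;> simp [h2]
      · have := h.2 h0 i
        ext (j | j) <;> simp [h2, this, neg_mulVec]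
  par_v₁ := by
    simp only [Sum.elim_inr, Sum.elim_inl, M.par_v₁]
    push_cast
    ring

/-- The Fock model of rank `2m`. -/
def fockModel (E : Type) [Field E] : (m : ℕ) → FockModel E m
  | 0 => FockModel.zero E
  | m + 1 => (fockModel E m).succ

/-- The operator attached to a vector of the standard hyperbolic basis. -/
def FockModel.op {E : Type} [Field E] {m : ℕ} (M : FockModel E m) :
    Fin m ⊕ Fin m → Matrix M.J M.J E := Sum.elim M.x M.y

lemma FockModel.op_mul_add {E : Type} [Field E] {m : ℕ} (M : FockModel E m)
    (p q : Fin m ⊕ Fin m) :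
    M.op p * M.op q + M.op q * M.op p = if p = q.swap then 1 else 0 := by
  rcases p with i | i <;> rcases q with j | j
  · simp [op, M.xx]
  · simp [op, M.xy]
  · simp only [op, Sum.elim_inl, Sum.elim_inr, Sum.swap_inl, Sum.inr.injEq]
    rw [add_comm, M.xy]
    simp [eq_comm]
  · simp [op, M.yy]

lemma FockModel.op_sq {E : Type} [Field E] {m : ℕ} (M : FockModel E m)
    (p : Fin m ⊕ Fin m) : M.op p * M.op p = 0 := by
  rcases p with i | i
  · exact M.x_sq i
  · exact M.y_sq i

lemma FockModel.op_odd {E : Type} [Field E] {m : ℕ} (M : FockModel E m)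
    (p : Fin m ⊕ Fin m) (j k : M.J) (h : M.op p j k ≠ 0) : M.par j = M.par k + 1 := by
  rcases p with i | i
  · exact M.x_odd i j k h
  · exact M.y_odd i j k h

lemma sum_sum_eq_zero_of_alternating {I R : Type} [AddCommGroup R] (s : Finset I)
    (G : I → I → R) (hG : ∀ p q, G p q + G q p = 0) (hG0 : ∀ p, G p p = 0) :
    ∑ p ∈ s, ∑ q ∈ s, G p q = 0 := by
  classical
  induction s using Finset.induction_on with
  | empty => simp
  | insert a s ha ih =>
    simp only [Finset.sum_insert ha, Finset.sum_add_distrib, hG0, zero_add, ih, add_zero]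
    rw [← Finset.sum_add_distrib]
    exact Finset.sum_eq_zero fun q _ => hG a q

/-- The standard hyperbolic quadratic form of rank `2m`, as the bilinear form
`(v, w) ↦ ∑ vᵢ wᵢ'`. -/
def hypBilin (E : Type) [Field E] (m : ℕ) : LinearMap.BilinForm E (Fin m ⊕ Fin m → E) :=
  LinearMap.mk₂ E (fun v w => ∑ i, v (Sum.inl i) * w (Sum.inr i))
    (fun a b c => by simp [add_mul, Finset.sum_add_distrib])
    (fun a b c => by simp [mul_assoc, Finset.mul_sum])
    (fun a b c => by simp [mul_add, Finset.sum_add_distrib])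
    (fun a b c => by simp [mul_left_comm, Finset.mul_sum])

/-- The standard hyperbolic quadratic form of rank `2m`. -/
def hypForm (E : Type) [Field E] (m : ℕ) : QuadraticForm E (Fin m ⊕ Fin m → E) :=
  LinearMap.BilinMap.toQuadraticMap (hypBilin E m)

lemma hypForm_apply {E : Type} [Field E] {m : ℕ} (v : Fin m ⊕ Fin m → E) :
    hypForm E m v = ∑ i, v (Sum.inl i) * v (Sum.inr i) := rfl

lemma sum_sum_smul_eq_hypForm_smul {E : Type} [Field E] {m : ℕ} {R : Type} [AddCommGroup R]
    [Module E R] (G : Fin m ⊕ Fin m → Fin m ⊕ Fin m → R) (c : R)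
    (hG : ∀ p q, G p q + G q p = if p = q.swap then c else 0) (hG0 : ∀ p, G p p = 0)
    (v : Fin m ⊕ Fin m → E) :
    ∑ p, ∑ q, (v p * v q) • G p q = hypForm E m v • c := by
  let β : Fin m ⊕ Fin m → Fin m ⊕ Fin m → R := fun p q =>
    Sum.elim (fun i => Sum.elim (fun _ => 0) (fun j => if i = j then c else 0) q) (fun _ => 0) p
  have h1 : ∑ p, ∑ q, (v p * v q) • (G p q - β p q) = 0 := by
    apply sum_sum_eq_zero_of_alternating
    · intro p q
      rw [mul_comm (v q), ← smul_add]
      have : G p q - β p q + (G q p - β q p) = (G p q + G q p) - (β p q + β q p) := by abel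
      rw [this, hG]
      have h : (if p = q.swap then c else 0) = β p q + β q p := by
        rcases p with i | i <;> rcases q with j | j <;> simp [β, eq_comm]
      rw [h, sub_self, smul_zero]
    · intro p
      rw [hG0]
      rcases p with i | i <;> simp [β]
  have h2 : ∑ p, ∑ q, (v p * v q) • β p q = hypForm E m v • c := by
    simp [β, hypForm_apply, Fintype.sum_sum_type, Finset.sum_smul]
  rw [← h2, ← sub_eq_zero, ← Finset.sum_sub_distrib, ← h1]
  refine Finset.sum_congr rfl fun p _ => ?_
  rw [← Finset.sum_sub_distrib]
  exact Finset.sum_congr rfl fun q _ => (smul_sub _ _ _).symm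

lemma finrank_cliffordAlgebra_hypForm (E : Type) [Field E] (m : ℕ) :
    Module.Finite E (CliffordAlgebra (hypForm E m)) ∧
    Module.finrank E (CliffordAlgebra (hypForm E m)) = 2 ^ m * 2 ^ m := by
  have h : LinearMap.BilinMap.toQuadraticMap (hypBilin E m) =
      hypForm E m - (0 : QuadraticForm E (Fin m ⊕ Fin m → E)) := by
    rw [sub_zero]; rfl
  let e : ExteriorAlgebra E (Fin m ⊕ Fin m → E) ≃ₗ[E] CliffordAlgebra (hypForm E m) :=
    CliffordAlgebra.changeFormEquiv h
  let b : Basis (Fin m ⊕ₗ Fin m) E (Fin m ⊕ Fin m → E) :=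
    (Pi.basisFun E (Fin m ⊕ Fin m)).reindex toLex
  let b' := b.ExteriorAlgebra.map e
  refine ⟨Module.Finite.of_basis b', ?_⟩
  rw [Module.finrank_eq_card_basis b', Fintype.card_finset]
  have : Fintype.card (Fin m ⊕ₗ Fin m) = m + m := by
    rw [← Fintype.card_congr (toLex (α := Fin m ⊕ Fin m))]; simp
  rw [this, pow_add]

/-- The spin representation of the full Clifford algebra. -/
def FockModel.spin {E : Type} [Field E] {m : ℕ} (M : FockModel E m) :
    CliffordAlgebra (hypForm E m) →ₐ[E] Matrix M.J M.J E :=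
  CliffordAlgebra.lift (hypForm E m) ⟨Fintype.linearCombination E M.op, fun v => by
    rw [Fintype.linearCombination_apply, Finset.sum_mul_sum, Algebra.algebraMap_eq_smul_one,
      ← sum_sum_smul_eq_hypForm_smul (fun p q => M.op p * M.op q) 1 M.op_mul_add M.op_sq]
    simp only [smul_mul_smul_comm]⟩

lemma FockModel.spin_ι {E : Type} [Field E] {m : ℕ} (M : FockModel E m)
    (v : Fin m ⊕ Fin m → E) :
    M.spin (CliffordAlgebra.ι _ v) = ∑ p, v p • M.op p := by
  simp [spin, Fintype.linearCombination_apply]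

lemma FockModel.spin_surjective {E : Type} [Field E] {m : ℕ} (M : FockModel E m) :
    Function.Surjective M.spin := by
  rw [← AlgHom.range_eq_top]
  have h : ∀ p, M.op p ∈ M.spin.range := fun p =>
    ⟨CliffordAlgebra.ι _ (Pi.single p 1), by
      simp [M.spin_ι, Pi.single_apply]⟩
  exact M.gen _ (fun i => h (Sum.inl i)) (fun i => h (Sum.inr i))

lemma FockModel.spin_injective {E : Type} [Field E] {m : ℕ} (M : FockModel E m) :
    Function.Injective M.spin := by
  obtain ⟨h, h'⟩ := finrank_cliffordAlgebra_hypForm E m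
  have := (LinearMap.injective_iff_surjective_of_finrank_eq_finrank
    (f := M.spin.toLinearMap) (by simp [h', Module.finrank_matrix, M.card])).2 M.spin_surjective
  exact this

/-- The matrices that shift the parity by `c`. -/
def FockModel.homog {E : Type} [Field E] {m : ℕ} (M : FockModel E m) (c : ZMod 2) :
    Submodule E (Matrix M.J M.J E) where
  carrier := {X | ∀ j k, X j k ≠ 0 → M.par j = M.par k + c}
  add_mem' := fun {X Y} hX hY j k h => by
    by_cases h' : X j k = 0
    · exact hY j k fun h'' => h (by simp [h', h''])
    · exact hX j k h'
  zero_mem' := by simp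
  smul_mem' := fun r X hX j k h => hX j k fun h' => h (by simp [h'])

lemma FockModel.mul_mem_homog {E : Type} [Field E] {m : ℕ} (M : FockModel E m) {c d : ZMod 2}
    {X Y : Matrix M.J M.J E} (hX : X ∈ M.homog c) (hY : Y ∈ M.homog d) :
    X * Y ∈ M.homog (c + d) := by
  intro j k h
  rw [Matrix.mul_apply] at h
  obtain ⟨l, -, hl⟩ := Finset.exists_ne_zero_of_sum_ne_zero h
  rw [hX j l (left_ne_zero_of_mul hl), hY l k (right_ne_zero_of_mul hl)]
  ring

lemma FockModel.eq_zero_of_homog {E : Type} [Field E] {m : ℕ} (M : FockModel E m)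
    {X : Matrix M.J M.J E} (h0 : X ∈ M.homog 0) (h1 : X ∈ M.homog 1) : X = 0 := by
  ext j k
  by_contra h
  have := (h0 j k h).symm.trans (h1 j k h)
  simp at this

lemma FockModel.spin_mem_homog {E : Type} [Field E] {m : ℕ} (M : FockModel E m)
    (c : ZMod 2) (y : CliffordAlgebra (hypForm E m))
    (hy : y ∈ CliffordAlgebra.evenOdd (hypForm E m) c) : M.spin y ∈ M.homog c := by
  have hι : ∀ v, M.spin (CliffordAlgebra.ι _ v) ∈ M.homog 1 := fun v => by
    rw [M.spin_ι]
    exact Submodule.sum_mem _ fun p _ => Submodule.smul_mem _ _ (M.op_odd p)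
  have h1 : (1 : Matrix M.J M.J E) ∈ M.homog 0 := fun j k h => by
    rw [add_zero]
    by_contra h'
    exact h (Matrix.one_apply_ne fun h'' => h' (by rw [h'']))
  have hιι : ∀ v w, ∀ c, ∀ x, M.spin x ∈ M.homog c →
      M.spin (CliffordAlgebra.ι _ v * CliffordAlgebra.ι _ w * x) ∈ M.homog c := by
    intro v w c x hx
    have h2 : (1 + 1 : ZMod 2) = 0 := rfl
    have := M.mul_mem_homog (M.mul_mem_homog (hι v) (hι w)) hx
    rwa [h2, zero_add, ← map_mul, ← map_mul] at this
  have hc : ∀ c : ZMod 2, c = 0 ∨ c = 1 := by decide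
  rcases hc c with rfl | rfl
  · induction y, hy using CliffordAlgebra.even_induction with
    | algebraMap r =>
      rw [AlgHom.commutes, Algebra.algebraMap_eq_smul_one]
      exact Submodule.smul_mem _ _ h1
    | add _ _ _ _ hx hy => rw [map_add]; exact add_mem hx hy
    | ι_mul_ι_mul v w x _ hx => exact hιι v w 0 x hx
  · induction y, hy using CliffordAlgebra.odd_induction with
    | ι v => exact hι v
    | add _ _ _ _ hx hy => rw [map_add]; exact add_mem hx hy
    | ι_mul_ι_mul v w x _ hx => exact hιι v w 1 x hx

lemma FockModel.exists_even_of_homog {E : Type} [Field E] {m : ℕ} (M : FockModel E m)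
    {X : Matrix M.J M.J E} (hX : X ∈ M.homog 0) :
    ∃ y ∈ CliffordAlgebra.evenOdd (hypForm E m) 0, M.spin y = X := by
  obtain ⟨y, rfl⟩ := M.spin_surjective X
  have hy : y ∈ CliffordAlgebra.evenOdd (hypForm E m) 0 ⊔
      CliffordAlgebra.evenOdd (hypForm E m) 1 := by
    rw [(CliffordAlgebra.evenOdd_isCompl _).sup_eq_top]; trivial
  obtain ⟨y0, h0, y1, h1, rfl⟩ := Submodule.mem_sup.1 hy
  refine ⟨y0, h0, ?_⟩
  have h := M.spin_mem_homog 1 y1 h1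
  have h' : M.spin y1 ∈ M.homog 0 := by
    have := Submodule.sub_mem _ hX (M.spin_mem_homog 0 y0 h0)
    rwa [map_add, add_sub_cancel_left] at this
  rw [map_add, M.eq_zero_of_homog h' h, add_zero]

/-- The elements `g p q` of `R` satisfy the relations of the products of two vectors of a
hyperbolic basis, and generate `R`. -/
structure IsEvenCliffordSystem {E : Type} [Field E] {m : ℕ} {R : Type} [Ring R] [Algebra E R]
    (g : Fin m ⊕ Fin m → Fin m ⊕ Fin m → R) : Prop where
  add_swap : ∀ p q, g p q + g q p = if p = q.swap then 1 else 0
  self : ∀ p, g p p = 0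
  mul_add_mul : ∀ p q r s, g p q * g r s + g p r * g q s = if q = r.swap then g p s else 0
  mul_self : ∀ p q s, g p q * g q s = 0
  gen : ∀ S : Subalgebra E R, (∀ p q, g p q ∈ S) → S = ⊤

/-- The bilinear map with matrix `g`. -/
def bilinOfCoeffs {E : Type} [Field E] {m : ℕ} {R : Type} [Ring R] [Algebra E R]
    (g : Fin m ⊕ Fin m → Fin m ⊕ Fin m → R) :
    (Fin m ⊕ Fin m → E) →ₗ[E] (Fin m ⊕ Fin m → E) →ₗ[E] R :=
  LinearMap.mk₂ E (fun v w => ∑ p, ∑ q, (v p * w q) • g p q)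
    (fun a b c => by simp only [Pi.add_apply, add_mul, add_smul, Finset.sum_add_distrib])
    (fun a b c => by simp only [Pi.smul_apply, smul_eq_mul, mul_assoc, mul_smul, Finset.smul_sum])
    (fun a b c => by simp only [Pi.add_apply, mul_add, add_smul, Finset.sum_add_distrib])
    (fun a b c => by
      simp only [Pi.smul_apply, smul_eq_mul, mul_left_comm _ a, mul_smul, Finset.smul_sum])

lemma bilinOfCoeffs_single {E : Type} [Field E] {m : ℕ} {R : Type} [Ring R] [Algebra E R]
    (g : Fin m ⊕ Fin m → Fin m ⊕ Fin m → R) (p q : Fin m ⊕ Fin m) :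
    bilinOfCoeffs (E := E) g (Pi.single p 1) (Pi.single q 1) = g p q := by
  rw [bilinOfCoeffs, LinearMap.mk₂_apply, Finset.sum_eq_single p, Finset.sum_eq_single q]
  · simp
  · intro b _ hb; simp [Pi.single_eq_of_ne hb]
  · simp
  · intro b _ hb; simp [Pi.single_eq_of_ne hb]
  · simp

namespace FockModel

variable {E : Type} [Field E] {m : ℕ}

open Matrix in
lemma forall_op_mul_eq_zero_iff (M : FockModel E m)
    (s : Fin m → Fin m ⊕ Fin m) (w : M.J)
    (hw : ∀ v : M.J → E, (∀ i, M.op (s i) *ᵥ v = 0) ↔ ∀ j, j ≠ w → v j = 0)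
    (X : Matrix M.J M.J E) :
    (∀ p i, M.op p * M.op (s i) * X = 0) ↔ ∀ j k, j ≠ w → X j k = 0 := by
  have h1 : (∀ p i, M.op p * M.op (s i) * X = 0) ↔ ∀ i, M.op (s i) * X = 0 := by
    constructor
    · intro H i
      have h2 := M.op_mul_add (s i).swap (s i)
      rw [if_pos rfl] at h2
      calc M.op (s i) * X = (M.op (s i).swap * M.op (s i) + M.op (s i) * M.op (s i).swap) *
            (M.op (s i) * X) := by rw [h2, one_mul]
        _ = M.op (s i).swap * (M.op (s i) * M.op (s i)) * X +
            M.op (s i) * (M.op (s i).swap * M.op (s i) * X) := by noncomm_ring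
        _ = 0 := by rw [M.op_sq, H]; simp
    · intro H p i
      rw [mul_assoc, H, mul_zero]
  rw [h1, forall_comm]
  constructor
  · intro H k j hj
    refine (hw fun l => X l k).1 (fun i => ?_) j hj
    ext l
    exact congrFun (congrFun (H i) l) k
  · intro H i
    ext j k
    exact congrFun ((hw fun l => X l k).2 (fun j hj => H k j hj) i) j

/-- The projection of the spin representation onto its summand containing the vacuum. -/
def parityProj (M : FockModel E m) : Matrix M.J M.J E :=
  Matrix.diagonal fun j => if M.par j = M.par M.v₀ then 1 else 0

lemma single_mem_homog (M : FockModel E m) {j k : M.J}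
    (h : M.par j = M.par k) : Matrix.single j k (1 : E) ∈ M.homog 0 := by
  intro a b hab
  by_contra h'
  apply hab
  rw [Matrix.single_apply, if_neg]
  rintro ⟨rfl, rfl⟩
  exact h' (by simp [h])

lemma eq_smul_of_commute (M : FockModel E m) (hm : Odd m)
    (Y : Matrix M.J M.J E) (hY : ∀ X ∈ M.homog 0, Y * X = X * Y) :
    ∃ α β : E, Y = α • 1 + β • M.parityProj := by
  have hs : ∀ j k, M.par j = M.par k → ∀ a b,
      (Y * Matrix.single j k (1 : E) : Matrix M.J M.J E) a b =
        (Matrix.single j k (1 : E) * Y : Matrix M.J M.J E) a b := fun j k h a b => by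
    rw [hY _ (M.single_mem_homog h)]
  have hpar : M.par M.v₁ ≠ M.par M.v₀ := by
    rw [M.par_v₁, (ZMod.natCast_eq_one_iff_odd).2 hm]
    simp
  have htwo : ∀ a b c : ZMod 2, a ≠ b → c ≠ b → c = a := by decide
  have hoff : ∀ i j, i ≠ j → Y i j = 0 := fun i j hij => by
    have := hs j j rfl i j
    simpa [Matrix.mul_apply, Matrix.single_apply, hij.symm] using this
  have hdiag : ∀ j k, M.par j = M.par k → Y j j = Y k k := fun j k h => by
    have := hs j k h j k
    simpa [Matrix.mul_apply, Matrix.single_apply] using this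
  refine ⟨Y M.v₁ M.v₁, Y M.v₀ M.v₀ - Y M.v₁ M.v₁, ?_⟩
  ext i j
  by_cases hij : i = j
  · subst hij
    by_cases hi : M.par i = M.par M.v₀
    · simp [parityProj, hi, hdiag i M.v₀ hi]
    · simp [parityProj, hi, hdiag i M.v₁ (htwo _ _ _ hpar hi)]
  · simp [parityProj, hoff i j hij, hij]

lemma parityProj_commute (M : FockModel E m)
    {X : Matrix M.J M.J E} (hX : X ∈ M.homog 0) :
    M.parityProj * X = X * M.parityProj := by
  ext i j
  rw [parityProj, Matrix.diagonal_mul, Matrix.mul_diagonal]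
  by_cases h : X i j = 0
  · simp [h]
  · have := hX i j h
    rw [add_zero] at this
    rw [this, mul_comm]

end FockModel

namespace IsEvenCliffordSystem

variable {E : Type} [Field E] {m : ℕ} {R : Type} [Ring R] [Algebra E R]
  {g : Fin m ⊕ Fin m → Fin m ⊕ Fin m → R}

/-- The bilinear map of an even Clifford system satisfies the universal relations of the even
Clifford algebra. -/
def evenHom (h : IsEvenCliffordSystem (E := E) g) : CliffordAlgebra.EvenHom (hypForm E m) R where
  bilin := bilinOfCoeffs g
  contract v := by
    rw [bilinOfCoeffs, LinearMap.mk₂_apply,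
      sum_sum_smul_eq_hypForm_smul g 1 h.add_swap h.self, Algebra.algebraMap_eq_smul_one]
  contract_mid u v w := by
    simp only [bilinOfCoeffs, LinearMap.mk₂_apply]
    have key : ∀ p s, ∑ q, ∑ r, (v q * v r) • (g p q * g r s) = hypForm E m v • g p s :=
      fun p s => sum_sum_smul_eq_hypForm_smul (fun q r => g p q * g r s) (g p s)
        (fun q r => h.mul_add_mul p q r s) (fun q => h.mul_self p q s) v
    calc (∑ p, ∑ q, (u p * v q) • g p q) * ∑ r, ∑ s, (v r * w s) • g r s
        = ∑ p, ∑ q, ∑ r, ∑ s, (u p * w s) • ((v q * v r) • (g p q * g r s)) := by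
          simp only [Finset.sum_mul]
          simp only [Finset.mul_sum, smul_mul_smul_comm, smul_smul]
          refine Finset.sum_congr rfl fun p _ => Finset.sum_congr rfl fun q _ =>
            Finset.sum_congr rfl fun r _ => Finset.sum_congr rfl fun s _ => ?_
          congr 1
          ring
      _ = ∑ p, ∑ s, (u p * w s) • ∑ q, ∑ r, (v q * v r) • (g p q * g r s) := by
          simp only [Finset.smul_sum]
          refine Finset.sum_congr rfl fun p _ => ?_
          rw [Finset.sum_comm (s := Finset.univ) (t := Finset.univ)
            (f := fun s q => ∑ r, (u p * w s) • (v q * v r) • (g p q * g r s))]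
          exact Finset.sum_congr rfl fun q _ => Finset.sum_comm
      _ = _ := by
          simp only [key, Finset.smul_sum]
          refine Finset.sum_congr rfl fun p _ => Finset.sum_congr rfl fun s _ => ?_
          rw [smul_comm]

lemma repr_injective (h : IsEvenCliffordSystem (E := E) g) (M : FockModel E m)
    (ρ : R →ₐ[E] Matrix M.J M.J E) (hρ : ∀ p q, ρ (g p q) = M.op p * M.op q) :
    Function.Injective ρ ∧ Set.range ρ = M.homog 0 := by
  let ψ := CliffordAlgebra.even.lift _ h.evenHom
  have hψ : ∀ v w, ψ ((CliffordAlgebra.even.ι _).bilin v w) = bilinOfCoeffs g v w :=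
    fun v w => CliffordAlgebra.even.lift_ι _ h.evenHom v w
  have hsurj : Function.Surjective ψ := by
    rw [← AlgHom.range_eq_top]
    refine h.gen _ fun p q => ⟨_, (hψ (Pi.single p 1) (Pi.single q 1)).trans ?_⟩
    exact bilinOfCoeffs_single g p q
  have hcomp : ρ.comp ψ = M.spin.comp (CliffordAlgebra.even (hypForm E m)).val := by
    refine CliffordAlgebra.even.algHom_ext _
      (CliffordAlgebra.EvenHom.ext (LinearMap.ext₂ fun v w => ?_))
    change ρ (ψ ((CliffordAlgebra.even.ι _).bilin v w)) =
      M.spin (CliffordAlgebra.ι _ v * CliffordAlgebra.ι _ w)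
    rw [hψ, map_mul, M.spin_ι, M.spin_ι, bilinOfCoeffs, LinearMap.mk₂_apply]
    simp only [map_sum, map_smul, hρ, Finset.sum_mul_sum, smul_mul_smul_comm]
  have hcomp' : ∀ y, ρ (ψ y) = M.spin y := fun y => DFunLike.congr_fun hcomp y
  constructor
  · rw [injective_iff_map_eq_zero]
    intro r hr
    obtain ⟨y, rfl⟩ := hsurj r
    rw [hcomp', map_eq_zero_iff _ M.spin_injective] at hr
    rw [show y = 0 from Subtype.ext hr, map_zero]
  · ext X
    constructor
    · rintro ⟨r, rfl⟩
      obtain ⟨y, rfl⟩ := hsurj r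
      rw [hcomp']
      exact M.spin_mem_homog 0 y y.2
    · intro hX
      obtain ⟨y, hy, rfl⟩ := M.exists_even_of_homog hX
      exact ⟨ψ ⟨y, hy⟩, hcomp' _⟩

theorem exists_central_idempotent (h : IsEvenCliffordSystem (E := E) g) (M : FockModel E m)
    (hm : Odd m) (ρ : R →ₐ[E] Matrix M.J M.J E) (hρ : ∀ p q, ρ (g p q) = M.op p * M.op q) :
    ∃ z : R, (∀ y, z * y = y * z) ∧
      (∀ y, (∀ x, y * x = x * y) → ∃ α β : E, y = α • 1 + β • z) ∧
      (∀ x, (∀ p i, g p (Sum.inr i) * x = 0) → z * x = x) ∧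
      (∃ x, x ≠ 0 ∧ ∀ p i, g p (Sum.inr i) * x = 0) ∧
      (∀ x, (∀ p i, g p (Sum.inl i) * x = 0) → z * x = 0) ∧
      (∃ x, x ≠ 0 ∧ ∀ p i, g p (Sum.inl i) * x = 0) := by
  obtain ⟨hinj, hrange⟩ := h.repr_injective M ρ hρ
  have hmem : ∀ y, ρ y ∈ M.homog 0 := fun y => by
    rw [← SetLike.mem_coe, ← hrange]; exact Set.mem_range_self y
  have hex : ∀ X ∈ M.homog 0, ∃ y, ρ y = X := fun X hX => by
    rwa [← SetLike.mem_coe, ← hrange] at hX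
  have hpar : M.par M.v₁ ≠ M.par M.v₀ := by
    rw [M.par_v₁, (ZMod.natCast_eq_one_iff_odd).2 hm]
    simp
  have hkill : ∀ (s : Fin m → Fin m ⊕ Fin m) (x : R),
      (∀ p i, g p (s i) * x = 0) ↔ ∀ p i, M.op p * M.op (s i) * ρ x = 0 := fun s x => by
    simp only [← hρ, ← map_mul, map_eq_zero_iff ρ hinj]
  have hr := fun x => (hkill Sum.inr x).trans
    (M.forall_op_mul_eq_zero_iff Sum.inr M.v₀ M.vac (ρ x))
  have hl := fun x => (hkill Sum.inl x).trans
    (M.forall_op_mul_eq_zero_iff Sum.inl M.v₁ M.full (ρ x))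
  have hex' : ∀ w : M.J, ∃ x : R, x ≠ 0 ∧ ∀ j k, j ≠ w → ρ x j k = 0 := fun w => by
    obtain ⟨x, hx⟩ := hex _ (M.single_mem_homog (j := w) (k := w) rfl)
    refine ⟨x, ?_, fun j k hj => ?_⟩
    · rintro rfl
      rw [map_zero] at hx
      simpa using congrFun (congrFun hx w) w
    · rw [hx, Matrix.single_apply, if_neg (fun h => hj h.1.symm)]
  obtain ⟨z, hz⟩ := hex M.parityProj fun j k hjk => by
    by_cases h' : j = k
    · rw [h', add_zero]
    · exact absurd (Matrix.diagonal_apply_ne _ h') hjk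
  refine ⟨z, fun y => hinj ?_, fun y hy => ?_, fun x hx => hinj ?_, ?_, fun x hx => hinj ?_, ?_⟩
  · rw [map_mul, map_mul, hz, M.parityProj_commute (hmem y)]
  · obtain ⟨α, β, hαβ⟩ := M.eq_smul_of_commute hm (ρ y) fun X hX => by
      obtain ⟨x, rfl⟩ := hex X hX
      rw [← map_mul, hy, map_mul]
    refine ⟨α, β, hinj ?_⟩
    rw [hαβ, map_add, map_smul, map_smul, map_one, hz]
  · rw [map_mul, hz]
    ext j k
    rw [FockModel.parityProj, Matrix.diagonal_mul]
    by_cases hj : j = M.v₀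
    · simp [hj]
    · rw [(hr x).1 hx j k hj, mul_zero]
  · simp only [hr]; exact hex' M.v₀
  · rw [map_mul, hz, map_zero]
    ext j k
    rw [FockModel.parityProj, Matrix.diagonal_mul]
    by_cases hj : j = M.v₁
    · simp [hj, hpar]
    · rw [(hl x).1 hx j k hj, mul_zero]; rfl
  · simp only [hl]; exact hex' M.v₁

end IsEvenCliffordSystem

open Matrix in
/-- Automorphisms of matrix algebras are inner. -/
lemma exists_forall_algEquiv_mul_eq {E : Type} [Field E] {n : ℕ}
    (f : Matrix (Fin n) (Fin n) E ≃ₐ[E] Matrix (Fin n) (Fin n) E) :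
    ∃ P Q : Matrix (Fin n) (Fin n) E, P * Q = 1 ∧ Q * P = 1 ∧ ∀ X, f X * P = P * X := by
  obtain ⟨e, he⟩ := AlgEquiv.eq_linearEquivConjAlgEquiv
    ((Matrix.toLinAlgEquiv'.symm.trans f).trans Matrix.toLinAlgEquiv')
  have he' : ∀ X, toLinAlgEquiv' (f X) = e.conjAlgEquiv E (toLinAlgEquiv' X) := fun X => by
    rw [← he]; simp
  refine ⟨toLinAlgEquiv'.symm e.toLinearMap, toLinAlgEquiv'.symm e.symm.toLinearMap,
    ?_, ?_, fun X => ?_⟩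
  · rw [← map_mul, ← map_one (toLinAlgEquiv' (R := E) (n := Fin n)).symm]
    congr 1
    exact LinearMap.ext fun x => e.apply_symm_apply x
  · rw [← map_mul, ← map_one (toLinAlgEquiv' (R := E) (n := Fin n)).symm]
    congr 1
    exact LinearMap.ext fun x => e.symm_apply_apply x
  · apply toLinAlgEquiv'.injective
    rw [map_mul, map_mul, he', AlgEquiv.apply_symm_apply]
    exact LinearMap.ext fun x => by simp [LinearEquiv.conjAlgEquiv_apply]

open Matrix in
/-- A linear involution of a matrix algebra is adjoint to a symmetric or skew form. -/
lemma exists_adjoint_matrix {E : Type} [Field E] {n : ℕ} (hn : n ≠ 0)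
    (σ : Matrix (Fin n) (Fin n) E →ₗ[E] Matrix (Fin n) (Fin n) E)
    (hmul : ∀ x y, σ (x * y) = σ y * σ x) (hinv : ∀ x, σ (σ x) = x) :
    ∃ g g' : Matrix (Fin n) (Fin n) E, g * g' = 1 ∧ g' * g = 1 ∧ (∀ X, g * σ X = Xᵀ * g) ∧
      (gᵀ = g ∨ gᵀ = -g) := by
  have h1 : σ 1 = 1 := by
    have := hmul (σ 1) 1
    rwa [mul_one, hinv, mul_one, eq_comm] at this
  let f : Matrix (Fin n) (Fin n) E ≃ₐ[E] Matrix (Fin n) (Fin n) E :=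
    AlgEquiv.ofBijective (AlgHom.ofLinearMap
      ((Matrix.transposeLinearEquiv (Fin n) (Fin n) E E).toLinearMap ∘ₗ σ)
      (by simp [h1]) (fun x y => by simp [hmul]))
      ⟨(Matrix.transposeLinearEquiv (Fin n) (Fin n) E E).injective.comp
        (Function.LeftInverse.injective (g := σ) hinv),
       (Matrix.transposeLinearEquiv (Fin n) (Fin n) E E).surjective.comp
        (fun x => ⟨σ x, hinv x⟩)⟩
  have hf : ∀ X, f X = (σ X)ᵀ := fun X => rfl
  obtain ⟨P, Q, hPQ, hQP, hP⟩ := exists_forall_algEquiv_mul_eq f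
  have hσ : ∀ X, Pᵀ * σ X = Xᵀ * Pᵀ := fun X => by
    have := congrArg transpose (hP X)
    rw [transpose_mul, transpose_mul, hf, transpose_transpose] at this
    exact this
  have hPQ' : Pᵀ * Qᵀ = 1 := by rw [← transpose_mul, hQP, transpose_one]
  have hQP' : Qᵀ * Pᵀ = 1 := by rw [← transpose_mul, hPQ, transpose_one]
  have hcomm : ∀ X, (Qᵀ * P) * X = X * (Qᵀ * P) := fun X => by
    have h2 := congrArg transpose (hσ X)
    rw [transpose_mul, transpose_mul, transpose_transpose, transpose_transpose] at h2
    have h3 := hσ (σ X)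
    rw [hinv] at h3
    calc (Qᵀ * P) * X = Qᵀ * (P * X) := by rw [mul_assoc]
      _ = Qᵀ * ((σ X)ᵀ * Pᵀ * Qᵀ * P) := by rw [← h2, mul_assoc _ Pᵀ, hPQ', mul_one]
      _ = (Qᵀ * Pᵀ) * X * (Qᵀ * P) := by rw [← h3]; simp only [mul_assoc]
      _ = X * (Qᵀ * P) := by rw [hQP', one_mul]
  obtain ⟨ε, hε⟩ := Matrix.mem_range_scalar_iff_commute_single'.2 fun i j =>
    (hcomm (single i j 1)).symm
  have hP' : P = ε • Pᵀ := by
    calc P = Pᵀ * (Qᵀ * P) := by rw [← mul_assoc, hPQ', one_mul]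
      _ = ε • Pᵀ := by rw [← hε]; ext i j; simp [mul_comm]
  have hε2 : ε * ε = 1 := by
    have h4 : P = (ε * ε) • P := by
      conv_lhs => rw [hP', hP']
      rw [transpose_smul, transpose_transpose, smul_smul]
    have h5 := congrArg (· * Q) h4
    simp only [smul_mul_assoc, hPQ] at h5
    have := congrFun (congrFun h5 ⟨0, Nat.pos_of_ne_zero hn⟩) ⟨0, Nat.pos_of_ne_zero hn⟩
    simpa using this.symm
  refine ⟨Pᵀ, Qᵀ, hPQ', hQP', hσ, ?_⟩
  rw [transpose_transpose]
  rcases mul_self_eq_one_iff.1 hε2 with rfl | rfl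
  · left; simpa using hP'
  · right; simpa using hP'

lemma two_mul_card_lt (n : ℕ) :
    2 * Fintype.card {p : Fin n × Fin n // p.1 < p.2} + n = n * n := by
  have h1 : ∀ p : Fin n × Fin n, (if p.1 < p.2 then 1 else 0) + (if p.2 < p.1 then 1 else 0) +
      (if p.1 = p.2 then 1 else 0) = 1 := fun p => by
    rcases lt_trichotomy p.1 p.2 with h | h | h
    · simp [h, h.not_gt, h.ne]
    · simp [h]
    · simp [h, h.not_gt, h.ne']
  have h2 := Finset.sum_congr rfl fun p (_ : p ∈ Finset.univ) => h1 p
  have h3 : ∑ p : Fin n × Fin n, (if p.2 < p.1 then 1 else 0) =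
      ∑ p : Fin n × Fin n, (if p.1 < p.2 then 1 else 0) :=
    (Equiv.prodComm _ _).sum_comp fun p : Fin n × Fin n => if p.1 < p.2 then 1 else 0
  have h4 : ∑ p : Fin n × Fin n, (if p.1 = p.2 then 1 else 0) = n := by
    rw [Fintype.sum_prod_type]; simp
  rw [Finset.sum_add_distrib, Finset.sum_add_distrib, h3, h4] at h2
  rw [Fintype.card_subtype, Finset.card_filter, two_mul, h2]
  simp

open Matrix in
lemma transpose_eq_of_finrank {E : Type} [Field E] {n : ℕ} (hn : n ≠ 0)
    (σ : Matrix (Fin n) (Fin n) E →ₗ[E] Matrix (Fin n) (Fin n) E)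
    (hdim : 2 * finrank E (LinearMap.ker (σ - LinearMap.id)) = n * (n + 1))
    {g g' : Matrix (Fin n) (Fin n) E} (hg : g' * g = 1) (hσ : ∀ X, g * σ X = Xᵀ * g)
    (h : gᵀ = g ∨ gᵀ = -g) : gᵀ = g := by
  refine h.elim id fun h => ?_
  by_cases h2 : (2 : E) = 0
  · rw [h]
    ext i j
    rw [neg_apply, neg_eq_iff_add_eq_zero, ← two_mul, h2, zero_mul]
  exfalso
  let φ : LinearMap.ker (σ - LinearMap.id) →ₗ[E] ({p : Fin n × Fin n // p.1 < p.2} → E) :=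
    { toFun := fun X p => (g * X.1) p.1.1 p.1.2
      map_add' := fun X Y => by ext; simp [mul_add]
      map_smul' := fun c X => by ext; simp }
  have hφ : Function.Injective φ := by
    rw [← LinearMap.ker_eq_bot, LinearMap.ker_eq_bot']
    rintro ⟨X, hX⟩ h0
    have hX' : σ X = X := by simpa [sub_eq_zero] using hX
    have hskew : (g * X)ᵀ = - (g * X) := by
      rw [transpose_mul, h, mul_neg, ← hσ, hX']
    have hz : g * X = 0 := by
      ext i j
      have hs : ∀ i j, (g * X) j i = - (g * X) i j := fun i j => congrFun (congrFun hskew i) j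
      have hu : ∀ i j, i < j → (g * X) i j = 0 := fun i j hij => congrFun h0 ⟨(i, j), hij⟩
      rcases lt_trichotomy i j with hij | rfl | hij
      · exact hu i j hij
      · have := hs i i
        rw [eq_neg_iff_add_eq_zero, ← two_mul] at this
        exact (mul_eq_zero.1 this).resolve_left h2
      · rw [hs, hu j i hij, neg_zero]; rfl
    ext1
    calc X = g' * (g * X) := by rw [← mul_assoc, hg, one_mul]
      _ = 0 := by rw [hz, mul_zero]
  have hle := LinearMap.finrank_le_finrank_of_injective hφ
  rw [Module.finrank_fintype_fun_eq_card] at hle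
  have := two_mul_card_lt n
  have hn' : 0 < n := Nat.pos_of_ne_zero hn
  nlinarith


open Matrix in
lemma exists_hyperbolic_basis {E : Type} [Field E] {n : ℕ} {g g' u : Matrix (Fin n) (Fin n) E}
    (hg : g' * g = 1) (hsymm : gᵀ = g) (hgu : g * (1 - u) = uᵀ * g) {a r : E}
    (hu : u * u = u + a • 1) (hr : r * r = r + a) (hr2 : 2 * r - 1 ≠ 0) :
    ∃ (m : ℕ) (b : Basis (Fin m ⊕ Fin m) E (Fin n → E)),
      (∀ p q, b p ⬝ᵥ g *ᵥ b q = if p = q.swap then 1 else 0) ∧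
      (∀ i, u *ᵥ b (Sum.inl i) = r • b (Sum.inl i)) ∧
      (∀ i, u *ᵥ b (Sum.inr i) = (1 - r) • b (Sum.inr i)) := by
  let V (t : E) : Submodule E (Fin n → E) := LinearMap.ker (u.mulVecLin - t • LinearMap.id)
  have hV : ∀ t v, v ∈ V t ↔ u *ᵥ v = t • v := fun t v => by simp [V, sub_eq_zero]
  have hadj : ∀ v w, v ⬝ᵥ g *ᵥ w = u *ᵥ v ⬝ᵥ g *ᵥ w + v ⬝ᵥ g *ᵥ (u *ᵥ w) := fun v w => by
    have : u *ᵥ v ⬝ᵥ g *ᵥ w = v ⬝ᵥ (uᵀ * g) *ᵥ w := by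
      rw [← mulVec_mulVec, dotProduct_mulVec v, vecMul_transpose]
    rw [this, ← hgu, mul_sub, mul_one, sub_mulVec, dotProduct_sub, mulVec_mulVec, sub_add_cancel]
  have hiso : ∀ t, 2 * t - 1 ≠ 0 → ∀ v ∈ V t, ∀ w ∈ V t, v ⬝ᵥ g *ᵥ w = 0 := by
    intro t ht v hv w hw
    have := hadj v w
    rw [(hV _ _).1 hv, (hV _ _).1 hw, mulVec_smul, smul_dotProduct, dotProduct_smul,
      smul_eq_mul] at this
    refine (mul_eq_zero.1 (?_ : (2 * t - 1) * (v ⬝ᵥ g *ᵥ w) = 0)).resolve_left ht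
    linear_combination -this
  have hr2' : 2 * (1 - r) - 1 ≠ 0 := fun h => hr2 (by linear_combination -h)
  have hcompl : IsCompl (V r) (V (1 - r)) := by
    constructor
    · rw [Submodule.disjoint_def]
      intro v h1 h2
      rw [hV] at h1 h2
      have : (2 * r - 1) • v = 0 := by
        rw [show 2 * r - 1 = r - (1 - r) by ring, sub_smul, ← h1, ← h2, sub_self]
      exact (smul_eq_zero.1 this).resolve_left hr2
    · rw [codisjoint_iff, eq_top_iff]
      intro v _
      have hu' : u *ᵥ (u *ᵥ v) = u *ᵥ v + a • v := by
        rw [mulVec_mulVec, hu, add_mulVec, smul_mulVec, one_mulVec]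
      rw [Submodule.mem_sup]
      refine ⟨(2 * r - 1)⁻¹ • (u *ᵥ v - (1 - r) • v), Submodule.smul_mem _ _ ?_,
        (2 * r - 1)⁻¹ • (r • v - u *ᵥ v), Submodule.smul_mem _ _ ?_, ?_⟩
      · rw [hV, mulVec_sub, hu', mulVec_smul]
        ext i
        simp
        linear_combination (-v i) * hr
      · rw [hV, mulVec_sub, hu', mulVec_smul]
        ext i
        simp
        linear_combination (v i) * hr
      · rw [← smul_add]
        ext i
        simp
        field_simp
        ring
  have hcomm : ∀ v w, v ⬝ᵥ g *ᵥ w = w ⬝ᵥ g *ᵥ v := fun v w => by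
    rw [dotProduct_mulVec, ← mulVec_transpose, hsymm, dotProduct_comm]
  have hnondeg : ∀ w, (∀ v, v ⬝ᵥ g *ᵥ w = 0) → w = 0 := fun w hw => by
    have h0 : g *ᵥ w = 0 := dotProduct_eq_zero _ fun v => by rw [dotProduct_comm]; exact hw v
    rw [← one_mulVec w, ← hg, ← mulVec_mulVec, h0, mulVec_zero]
  let c (s t : E) : V t →ₗ[E] Dual E (V s) := LinearMap.mk₂ E
    (fun w v => (v : Fin n → E) ⬝ᵥ g *ᵥ (w : Fin n → E))
    (fun w w' v => by simp [mulVec_add]) (fun k w v => by simp [mulVec_smul])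
    (fun w v v' => by simp) (fun k w v => by simp)
  have hc : ∀ s t, IsCompl (V s) (V t) → 2 * t - 1 ≠ 0 → Function.Injective (c s t) := by
    intro s t hst ht
    rw [← LinearMap.ker_eq_bot, LinearMap.ker_eq_bot']
    intro w hw
    ext1
    refine hnondeg _ fun v => ?_
    obtain ⟨x, hx, y, hy, rfl⟩ := Submodule.mem_sup.1
      (hst.sup_eq_top ▸ Submodule.mem_top : v ∈ V s ⊔ V t)
    rw [add_dotProduct, hiso t ht y hy w w.2, add_zero]
    exact LinearMap.congr_fun hw ⟨x, hx⟩
  have h1 := LinearMap.finrank_le_finrank_of_injective (hc _ _ hcompl hr2')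
  have h2 := LinearMap.finrank_le_finrank_of_injective (hc _ _ hcompl.symm hr2)
  rw [Subspace.dual_finrank_eq] at h1 h2
  let e : V (1 - r) ≃ₗ[E] Dual E (V r) := LinearEquiv.ofInjectiveOfFinrankEq (c r (1 - r))
    (hc _ _ hcompl hr2') (by rw [Subspace.dual_finrank_eq]; omega)
  let b₁ := finBasis E (V r)
  let b₂ := b₁.dualBasis.map e.symm
  let b := (b₁.prod b₂).map (Submodule.prodEquivOfIsCompl _ _ hcompl)
  have hbl : ∀ i, b (Sum.inl i) = b₁ i := fun i => by simp [b]
  have hbr : ∀ i, b (Sum.inr i) = b₂ i := fun i => by simp [b]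
  have hlr : ∀ i j, b (Sum.inl i) ⬝ᵥ g *ᵥ b (Sum.inr j) = if i = j then 1 else 0 := fun i j => by
    have : c r (1 - r) (b₂ j) = b₁.dualBasis j := e.apply_symm_apply _
    rw [hbl, hbr]
    refine (LinearMap.congr_fun this (b₁ i)).trans ?_
    rw [Basis.dualBasis_apply_self]
  refine ⟨_, b, ?_, fun i => ?_, fun i => ?_⟩
  · rintro (i | i) (j | j)
    · rw [hbl, hbl, hiso r hr2 _ (b₁ i).2 _ (b₁ j).2]; simp
    · rw [hlr]; simp
    · rw [hcomm, hlr]; simp [eq_comm]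
    · rw [hbr, hbr, hiso _ hr2' _ (b₂ i).2 _ (b₂ j).2]; simp
  · rw [hbl]; exact (hV _ _).1 (b₁ i).2
  · rw [hbr]; exact (hV _ _).1 (b₂ i).2

open Matrix in
lemma exists_algEquiv_hyperbolic {E : Type} [Field E] {n : ℕ} {g g' u : Matrix (Fin n) (Fin n) E}
    (σ : Matrix (Fin n) (Fin n) E →ₗ[E] Matrix (Fin n) (Fin n) E)
    (hg : g' * g = 1) (hsymm : gᵀ = g) (hσ : ∀ X, g * σ X = Xᵀ * g) (hσu : σ u = 1 - u) {a r : E}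
    (hu : u * u = u + a • 1) (hr : r * r = r + a) (hr2 : 2 * r - 1 ≠ 0) :
    ∃ (m : ℕ) (Φ : Matrix (Fin n) (Fin n) E ≃ₐ[E] Matrix (Fin m ⊕ Fin m) (Fin m ⊕ Fin m) E),
      (∀ x p q, Φ (σ x) p q = Φ x q.swap p.swap) ∧
      Φ u = Matrix.diagonal (Sum.elim (fun _ => r) (fun _ => 1 - r)) := by
  obtain ⟨m, b, hb, hl, hr'⟩ := exists_hyperbolic_basis hg hsymm (hσu ▸ hσ u) hu hr hr2
  let Φ := toLinAlgEquiv'.trans (LinearMap.toMatrixAlgEquiv b)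
  have hrepr : ∀ v p, b.repr v p = b p.swap ⬝ᵥ g *ᵥ v := fun v p => by
    conv_rhs => rw [← b.sum_repr v]
    simp only [mulVec_sum, mulVec_smul, dotProduct_sum, dotProduct_smul, hb,
      Sum.swap_leftInverse.injective.eq_iff, smul_eq_mul, mul_ite, mul_one, mul_zero,
      Finset.sum_ite_eq, Finset.mem_univ, if_true]
  have hΦ : ∀ X p q, Φ X p q = b p.swap ⬝ᵥ g *ᵥ (X *ᵥ b q) := fun X p q => by
    rw [← hrepr]
    simp [Φ, LinearMap.toMatrixAlgEquiv_apply]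
  have hΦ' : ∀ X p q, Φ X p q = b.repr (X *ᵥ b q) p := fun X p q => by
    simp [Φ, LinearMap.toMatrixAlgEquiv_apply]
  have hcomm : ∀ v w, v ⬝ᵥ g *ᵥ w = w ⬝ᵥ g *ᵥ v := fun v w => by
    rw [dotProduct_mulVec, ← mulVec_transpose, hsymm, dotProduct_comm]
  refine ⟨m, Φ, fun x p q => ?_, ?_⟩
  · rw [hΦ, hΦ, Sum.swap_swap, mulVec_mulVec, hσ, ← mulVec_mulVec, hcomm (b q),
      dotProduct_mulVec (b p.swap), vecMul_transpose]
  · ext p q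
    rw [hΦ']
    rcases q with j | j
    · rw [hl, diagonal_apply]
      by_cases h : p = Sum.inl j
      · simp [h]
      · simp [h]
    · rw [hr', diagonal_apply]
      by_cases h : p = Sum.inr j
      · simp [h]
      · simp [h]

/-- Over a splitting field, an orthogonal involution together with an element `u` such that
`σ u = 1 - u` takes a standard form. -/
lemma exists_standard_form {E : Type} [Field E] {n : ℕ} (hn : n ≠ 0)
    (σ : Matrix (Fin n) (Fin n) E →ₗ[E] Matrix (Fin n) (Fin n) E)
    (hmul : ∀ x y, σ (x * y) = σ y * σ x) (hinv : ∀ x, σ (σ x) = x)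
    (hdim : 2 * finrank E (LinearMap.ker (σ - LinearMap.id)) = n * (n + 1))
    {u : Matrix (Fin n) (Fin n) E} (hσu : σ u = 1 - u) {a r : E}
    (hu : u * u = u + a • 1) (hr : r * r = r + a) (hr2 : 2 * r - 1 ≠ 0) :
    ∃ (m : ℕ) (Φ : Matrix (Fin n) (Fin n) E ≃ₐ[E] Matrix (Fin m ⊕ Fin m) (Fin m ⊕ Fin m) E),
      (∀ x p q, Φ (σ x) p q = Φ x q.swap p.swap) ∧
      Φ u = Matrix.diagonal (Sum.elim (fun _ => r) (fun _ => 1 - r)) := by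
  obtain ⟨g, g', -, hg, hσ, hε⟩ := exists_adjoint_matrix hn σ hmul hinv
  exact exists_algEquiv_hyperbolic σ hg (transpose_eq_of_finrank hn σ hdim hg hσ hε) hσ hσu hu hr hr2

lemma finrank_ker_baseChange {F E V W : Type} [Field F] [Field E] [Algebra F E] [AddCommGroup V]
    [Module F V] [AddCommGroup W] [Module F W] (f : V →ₗ[F] W) :
    finrank E (LinearMap.ker (f.baseChange E)) = finrank F (LinearMap.ker f) := by
  have e : E ⊗[F] LinearMap.ker f ≃ₗ[E] LinearMap.ker (f.baseChange E) :=
    LinearMap.tensorKerEquiv E E f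
  rw [← e.finrank_eq, Module.finrank_baseChange]

/-- Splitting isomorphisms extend along extensions of the splitting field. -/
lemma exists_splitting_of_isScalarTower {F A E₀ E : Type} [Field F] [Ring A] [Algebra F A]
    [Module.Finite F A] [Field E₀] [Algebra F E₀] [Field E] [Algebra F E] [Algebra E₀ E]
    [IsScalarTower F E₀ E] {n : ℕ} (e : E₀ ⊗[F] A ≃ₐ[E₀] Matrix (Fin n) (Fin n) E₀) :
    ∃ e' : E ⊗[F] A ≃ₐ[E] Matrix (Fin n) (Fin n) E,
      ∀ a, e' (1 ⊗ₜ a) = (e (1 ⊗ₜ a)).map (algebraMap E₀ E) := by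
  let ψ : A →ₐ[F] Matrix (Fin n) (Fin n) E := ((IsScalarTower.toAlgHom F E₀ E).mapMatrix.comp
    (e.toAlgHom.restrictScalars F)).comp Algebra.TensorProduct.includeRight
  have hψ : ∀ a, ψ a = (e (1 ⊗ₜ a)).map (algebraMap E₀ E) := fun a => rfl
  let Ψ : E ⊗[F] A →ₐ[E] Matrix (Fin n) (Fin n) E :=
    Algebra.TensorProduct.lift (Algebra.ofId E _) ψ fun x y => Algebra.commutes x (ψ y)
  have hΨ : ∀ c a, Ψ (c ⊗ₜ a) = c • ψ a := fun c a => by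
    rw [Algebra.smul_def]
    exact Algebra.TensorProduct.lift_tmul _ _ _ _ _
  have hrange : ∀ x : E₀ ⊗[F] A, (e x).map (algebraMap E₀ E) ∈ LinearMap.range Ψ.toLinearMap :=
    fun x => by
      induction x using TensorProduct.induction_on with
      | zero => rw [map_zero, Matrix.map_zero _ (map_zero _)]; exact zero_mem _
      | tmul c a =>
        refine ⟨algebraMap E₀ E c ⊗ₜ a, ?_⟩
        have hc : e (c ⊗ₜ a) = c • e (1 ⊗ₜ a) := by
          rw [← map_smul, TensorProduct.smul_tmul', smul_eq_mul, mul_one]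
        rw [AlgHom.toLinearMap_apply, hΨ, hψ, hc]
        ext i j
        simp
      | add x y hx hy => rw [map_add, Matrix.map_add _ (map_add _)]; exact add_mem hx hy
  have hsurj : Function.Surjective Ψ.toLinearMap := by
    rw [← LinearMap.range_eq_top, eq_top_iff]
    intro X _
    rw [Matrix.matrix_eq_sum_single X]
    refine Submodule.sum_mem _ fun i _ => Submodule.sum_mem _ fun j _ => ?_
    have h := hrange (e.symm (Matrix.single i j 1))
    rw [AlgEquiv.apply_symm_apply] at h
    convert! Submodule.smul_mem _ (X i j) h using 1
    ext k l
    simp [Matrix.single_apply]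
  have hdim : finrank E (E ⊗[F] A) = finrank E (Matrix (Fin n) (Fin n) E) := by
    have := e.toLinearEquiv.finrank_eq
    rw [Module.finrank_baseChange, Module.finrank_matrix] at this ⊢
    simpa using this
  have hbij : Function.Bijective Ψ :=
    ⟨(LinearMap.injective_iff_surjective_of_finrank_eq_finrank hdim).2 hsurj, hsurj⟩
  refine ⟨AlgEquiv.ofBijective Ψ hbij, fun a => ?_⟩
  rw [AlgEquiv.ofBijective_apply, hΨ, one_smul, hψ]

/-- A reduced trace may be computed over an algebraically closed splitting field. -/
lemma IsReducedTrace.exists_isAlgClosed {F A : Type} [Field F] [Ring A] [Algebra F A]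
    [Module.Finite F A] {T : A →ₗ[F] F} (hT : IsReducedTrace F A T) :
    ∃ (E : Type) (_ : Field E) (_ : Algebra F E) (_ : IsAlgClosed E) (n : ℕ)
      (e : E ⊗[F] A ≃ₐ[E] Matrix (Fin n) (Fin n) E),
      ∀ a : A, algebraMap F E (T a) = Matrix.trace (e ((1 : E) ⊗ₜ[F] a)) := by
  obtain ⟨E₀, _, _, n, e, he⟩ := hT
  obtain ⟨e', he'⟩ := exists_splitting_of_isScalarTower (E := AlgebraicClosure E₀) e
  refine ⟨AlgebraicClosure E₀, inferInstance, inferInstance, inferInstance, n, e', fun a => ?_⟩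
  rw [he', IsScalarTower.algebraMap_apply F E₀ (AlgebraicClosure E₀), he]
  simp [Matrix.trace]


lemma two_mul_sub_one_ne_zero {F E : Type} [Field F] [Field E] [Algebra F E] {a : F}
    (ha : (1 : F) + 4 * a ≠ 0) {r : E} (hr : r * r = r + algebraMap F E a) : 2 * r - 1 ≠ 0 := by
  intro h
  apply ha
  apply (algebraMap F E).injective
  rw [map_add, map_mul, map_one, map_ofNat, map_zero]
  linear_combination (2 * r - 1) * h - 4 * hr

/-- Over a suitable field extension, an algebra with quadratic pair containing an element `u` with
`σ u = 1 - u` and `u² - u ∈ F` takes a standard form. -/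
theorem exists_frame {F A : Type} [Field F] [Ring A] [Algebra F A] (hA : IsCSA F A)
    {T : A →ₗ[F] F} (hT : IsReducedTrace F A T) {σ : A →ₗ[F] A} (hσ : IsInvolution F σ)
    (hdim : 2 * Module.finrank F (symSet F σ) = deg F A * (deg F A + 1))
    {u : A} {a : F} (hu : u * u = u + algebraMap F A a) (hσu : σ u = 1 - u)
    (ha : (1 : F) + 4 * a ≠ 0) :
    ∃ (E : Type) (_ : Field E) (_ : Algebra F E) (r : E) (m : ℕ)
      (Φ : E ⊗[F] A ≃ₐ[E] Matrix (Fin m ⊕ Fin m) (Fin m ⊕ Fin m) E),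
      r * r = r + algebraMap F E a ∧
      (∀ x p q, Φ (1 ⊗ₜ σ x) p q = Φ (1 ⊗ₜ x) q.swap p.swap) ∧
      (∀ x, algebraMap F E (T x) = Matrix.trace (Φ (1 ⊗ₜ x))) ∧
      Φ (1 ⊗ₜ u) = Matrix.diagonal (Sum.elim (fun _ => r) (fun _ => 1 - r)) := by
  obtain ⟨-, _, _⟩ := hA
  obtain ⟨E, _, _, _, n, e, he⟩ := hT.exists_isAlgClosed
  obtain ⟨r, hr⟩ : ∃ r : E, r * r = r + algebraMap F E a := by
    have h : (Polynomial.X ^ 2 - Polynomial.X - Polynomial.C (algebraMap F E a)).degree = 2 := by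
      compute_degree!
    obtain ⟨r, hr⟩ := IsAlgClosed.exists_root _ (h ▸ two_ne_zero)
    refine ⟨r, ?_⟩
    simp only [Polynomial.IsRoot.def, Polynomial.eval_sub, Polynomial.eval_pow, Polynomial.eval_X,
      Polynomial.eval_C] at hr
    linear_combination hr
  have hfin : finrank F A = n * n := by
    have := e.toLinearEquiv.finrank_eq
    rw [Module.finrank_baseChange, Module.finrank_matrix] at this
    simpa using this
  have hn : n ≠ 0 := by
    rintro rfl
    have := Module.finrank_pos (R := F) (M := A)
    omega
  have hdeg : deg F A = n := by rw [deg, hfin, Nat.sqrt_eq]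
  let σ' : Matrix (Fin n) (Fin n) E →ₗ[E] Matrix (Fin n) (Fin n) E :=
    e.toLinearMap ∘ₗ σ.baseChange E ∘ₗ e.symm.toLinearMap
  have hσ' : ∀ x, σ' (e x) = e (σ.baseChange E x) := fun x => by simp [σ']
  have hmul : ∀ x y : E ⊗[F] A, σ.baseChange E (x * y) = σ.baseChange E y * σ.baseChange E x := by
    intro x y
    induction x using TensorProduct.induction_on with
    | zero => simp
    | add x x' hx hx' => rw [add_mul, map_add, hx, hx', map_add, mul_add]
    | tmul c x =>
      induction y using TensorProduct.induction_on with
      | zero => simp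
      | add y y' hy hy' => rw [mul_add, map_add, hy, hy', map_add, add_mul]
      | tmul d y => simp [hσ.1, mul_comm]
  have hinv : ∀ x : E ⊗[F] A, σ.baseChange E (σ.baseChange E x) = x := fun x => by
    induction x using TensorProduct.induction_on with
    | zero => simp
    | add x x' hx hx' => rw [map_add, map_add, hx, hx']
    | tmul c x => simp [hσ.2]
  have hker : 2 * finrank E (LinearMap.ker (σ' - LinearMap.id)) = n * (n + 1) := by
    have hk : LinearMap.ker (σ' - LinearMap.id) =
        (LinearMap.ker ((σ - LinearMap.id).baseChange E)).map e.toLinearEquiv.toLinearMap := by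
      ext x
      obtain ⟨x, rfl⟩ := e.surjective x
      rw [Submodule.mem_map_equiv, LinearMap.mem_ker, LinearMap.mem_ker, LinearMap.baseChange_sub,
        LinearMap.baseChange_id, LinearMap.sub_apply, LinearMap.sub_apply, hσ', LinearMap.id_apply,
        ← map_sub, map_eq_zero_iff e e.injective]
      simp
    rw [hk, LinearEquiv.finrank_map_eq, finrank_ker_baseChange, ← hdeg]
    exact hdim
  obtain ⟨m, Ψ, h1, h2⟩ := exists_standard_form hn σ'
    (fun x y => by
      obtain ⟨x, rfl⟩ := e.surjective x
      obtain ⟨y, rfl⟩ := e.surjective y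
      rw [← map_mul, hσ', hσ', hσ', hmul, map_mul])
    (fun x => by
      obtain ⟨x, rfl⟩ := e.surjective x
      rw [hσ', hσ', hinv]) hker (u := e (1 ⊗ₜ u))
    (by
      rw [hσ', LinearMap.baseChange_tmul, hσu, TensorProduct.tmul_sub, map_sub,
        ← Algebra.TensorProduct.one_def, map_one])
    (by
      rw [← map_mul, Algebra.TensorProduct.tmul_mul_tmul, hu, mul_one, TensorProduct.tmul_add,
        map_add, Algebra.algebraMap_eq_smul_one, TensorProduct.tmul_smul,
        ← Algebra.TensorProduct.one_def, algebra_compatible_smul E a, map_smul, map_one])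
    hr (two_mul_sub_one_ne_zero ha hr)
  refine ⟨E, _, _, r, m, e.trans Ψ, hr, fun x p q => ?_, fun x => ?_, h2⟩
  · rw [← LinearMap.baseChange_tmul]
    simp only [AlgEquiv.trans_apply]
    rw [← hσ', h1]
  · rw [he, AlgEquiv.trans_apply, Matrix.trace_map]

section Quadratic

variable {F K : Type} [Field F] [CommRing K] [Algebra F K] {u : K}

lemma smul_one_add_smul_eq_zero (hK2 : finrank F K = 2) (hugen : u ∉ Set.range (algebraMap F K))
    {α β : F} (h : α • (1 : K) + β • u = 0) : α = 0 ∧ β = 0 := by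
  have : Nontrivial K := Module.nontrivial_of_finrank_pos (R := F) (by omega)
  have hβ : β = 0 := by
    by_contra hβ
    refine hugen ⟨-(β⁻¹ * α), ?_⟩
    have h2 : β • u = -(α • (1 : K)) := (eq_neg_of_add_eq_zero_right h)
    rw [← inv_smul_smul₀ hβ u, h2, Algebra.algebraMap_eq_smul_one, smul_neg, smul_smul, neg_smul]
  refine ⟨?_, hβ⟩
  rw [hβ, zero_smul, add_zero] at h
  exact (smul_eq_zero.1 h).resolve_right one_ne_zero

lemma exists_eq_smul_one_add_smul (hK2 : finrank F K = 2)
    (hugen : u ∉ Set.range (algebraMap F K)) (k : K) : ∃ α β : F, k = α • (1 : K) + β • u := by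
  have hli : LinearIndependent F ![(1 : K), u] :=
    LinearIndependent.pair_iff.2 fun α β h => smul_one_add_smul_eq_zero hK2 hugen h
  let b := basisOfLinearIndependentOfCardEqFinrank hli (by simp [hK2])
  refine ⟨b.repr k 0, b.repr k 1, ?_⟩
  conv_lhs => rw [← b.sum_repr k]
  simp [b]

variable {C : Type} [Ring C] [Algebra F C] [Algebra K C] [IsScalarTower F K C]

/-- An algebra with unitary involution is free over its centre, with basis an `F`-basis of the
space of symmetric elements. -/
lemma finrank_eq_two_mul_finrank_of_unitary [Module.Finite F C] (hK2 : finrank F K = 2)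
    (hugen : u ∉ Set.range (algebraMap F K)) {a : F} (hu : u * u = u + algebraMap F K a)
    (ha : (1 : F) + 4 * a ≠ 0) {ι : K ≃ₐ[F] K} (hι : ι u = 1 - u) {σC : C →ₗ[F] C}
    (hσC : IsInvolution F σC)
    (hunitary : ∀ x : K, σC (algebraMap K C x) = algebraMap K C (ι x)) :
    finrank F C = 2 * finrank K C := by
  have : Nontrivial K := Module.nontrivial_of_finrank_pos (R := F) (by omega)
  have hsmul : ∀ (k : K) (c : C), σC (k • c) = ι k • σC c := fun k c => by
    rw [Algebra.smul_def, hσC.1, hunitary, Algebra.smul_def, Algebra.commutes]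
  have hmem : ∀ c, c ∈ symSet F σC ↔ σC c = c := fun c => by simp [symSet, sub_eq_zero]
  have hsq : ((2 * u - 1) * (2 * u - 1) : K) = algebraMap F K (1 + 4 * a) := by
    simp only [map_add, map_mul, map_one, map_ofNat]
    linear_combination 4 * hu
  obtain ⟨w, hw, hιw⟩ : ∃ w : K, w * (2 * u - 1) = 1 ∧ ι w = - w := by
    refine ⟨algebraMap F K (1 + 4 * a)⁻¹ * (2 * u - 1), ?_, ?_⟩
    · rw [mul_assoc, hsq, ← map_mul, inv_mul_cancel₀ ha, map_one]
    · rw [map_mul, AlgEquiv.commutes, map_sub, map_mul, hι, map_one, map_ofNat]; ring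
  have huniq : ∀ s ∈ symSet F σC, ∀ t ∈ symSet F σC, s + u • t = 0 → s = 0 ∧ t = 0 := by
    intro s hs t ht h
    have h2 := congrArg σC h
    rw [map_add, hsmul, (hmem s).1 hs, (hmem t).1 ht, hι, map_zero] at h2
    have h3 : (2 * u - 1) • t = 0 := by
      have : (2 * u - 1) • t = (s + u • t) - (s + (1 - u) • t) := by module
      rw [this, h, h2, sub_zero]
    have h4 : t = 0 := by rw [← one_smul K t, ← hw, mul_smul, h3, smul_zero]
    exact ⟨by rwa [h4, smul_zero, add_zero] at h, h4⟩
  have hex : ∀ c, ∃ s ∈ symSet F σC, ∃ t ∈ symSet F σC, c = s + u • t := by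
    intro c
    have ht : σC (w • (c - σC c)) = w • (c - σC c) := by
      rw [hsmul, hιw, map_sub, hσC.2, neg_smul, ← smul_neg, neg_sub]
    refine ⟨c - u • w • (c - σC c), (hmem _).2 ?_, w • (c - σC c), (hmem _).2 ht, by abel⟩
    rw [map_sub, hsmul, ht, hι]
    have : c - σC c = (w * (2 * u - 1)) • (c - σC c) := by rw [hw, one_smul]
    have h : σC c - (1 - u) • w • (c - σC c) - (c - u • w • (c - σC c)) =
      (w * (2 * u - 1)) • (c - σC c) - (c - σC c) := by module
    rw [← sub_eq_zero, h, ← this, sub_self]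
  let b := finBasis F (symSet F σC)
  have hcomb : ∀ α β : Fin (finrank F (symSet F σC)) → F,
      ∑ i, (α i • (1 : K) + β i • u) • (b i : C) =
        ((∑ i, α i • b i : symSet F σC) : C) + u • ((∑ i, β i • b i : symSet F σC) : C) := by
    intro α β
    simp only [Submodule.coe_sum, Submodule.coe_smul, Finset.smul_sum, ← Finset.sum_add_distrib]
    refine Finset.sum_congr rfl fun i _ => ?_
    rw [add_smul, smul_assoc, smul_assoc, one_smul, smul_comm]
  let B : Basis (Fin (finrank F (symSet F σC))) K C := Basis.mk (v := fun i => (b i : C))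
    (by
      rw [Fintype.linearIndependent_iff]
      intro k hk
      choose α β hαβ using fun i => exists_eq_smul_one_add_smul hK2 hugen (k i)
      simp only [hαβ] at hk
      rw [hcomb] at hk
      obtain ⟨h1, h2⟩ := huniq _ (Subtype.prop _) _ (Subtype.prop _) hk
      rw [Submodule.coe_eq_zero] at h1 h2
      intro i
      rw [hαβ, Fintype.linearIndependent_iff.1 b.linearIndependent α h1,
        Fintype.linearIndependent_iff.1 b.linearIndependent β h2]
      simp)
    (by
      intro c _
      obtain ⟨s, hs, t, ht, rfl⟩ := hex c
      have := hcomb (b.repr ⟨s, hs⟩) (b.repr ⟨t, ht⟩)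
      rw [b.sum_repr, b.sum_repr] at this
      rw [← this]
      exact Submodule.sum_mem _ fun i _ => Submodule.smul_mem _ _ (Submodule.subset_span ⟨i, rfl⟩))
  have : Module.Free K C := Module.Free.of_basis B
  rw [← finrank_mul_finrank F K C, hK2]

end Quadratic

section Centralizer

open Matrix in
lemma finrank_commutant_diagonal {E : Type} [Field E] (m : ℕ) {r s : E} (h : r ≠ s) :
    finrank E (LinearMap.ker
      (LinearMap.mulLeft E (diagonal (Sum.elim (fun _ : Fin m => r) (fun _ : Fin m => s))) -
       LinearMap.mulRight E (diagonal (Sum.elim (fun _ : Fin m => r) (fun _ : Fin m => s))))) =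
      2 * (m * m) := by
  let f : Matrix (Fin m) (Fin m) E × Matrix (Fin m) (Fin m) E →ₗ[E]
      Matrix (Fin m ⊕ Fin m) (Fin m ⊕ Fin m) E :=
    { toFun := fun X => fromBlocks X.1 0 0 X.2
      map_add' := fun X Y => by simp [fromBlocks_add]
      map_smul' := fun c X => by simp [fromBlocks_smul] }
  have hf : Function.Injective f := fun X Y hXY => by
    have := fromBlocks_inj.1 hXY
    exact Prod.ext this.1 this.2.2.2
  have hrange : LinearMap.range f = LinearMap.ker
      (LinearMap.mulLeft E (diagonal (Sum.elim (fun _ : Fin m => r) (fun _ : Fin m => s))) -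
       LinearMap.mulRight E (diagonal (Sum.elim (fun _ : Fin m => r) (fun _ : Fin m => s)))) := by
    ext X
    rw [LinearMap.mem_ker, LinearMap.sub_apply, LinearMap.mulLeft_apply, LinearMap.mulRight_apply,
      sub_eq_zero]
    constructor
    · rintro ⟨Y, rfl⟩
      ext (i | i) (j | j) <;> simp [f, mul_comm]
    · intro H
      have h12 : ∀ i j, X (Sum.inl i) (Sum.inr j) = 0 := fun i j => by
        have := congrFun (congrFun H (Sum.inl i)) (Sum.inr j)
        simp only [diagonal_mul, mul_diagonal, Sum.elim_inl, Sum.elim_inr] at this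
        exact (mul_eq_zero.1 (by linear_combination this :
          (r - s) * X (Sum.inl i) (Sum.inr j) = 0)).resolve_left (sub_ne_zero.2 h)
      have h21 : ∀ i j, X (Sum.inr i) (Sum.inl j) = 0 := fun i j => by
        have := congrFun (congrFun H (Sum.inr i)) (Sum.inl j)
        simp only [diagonal_mul, mul_diagonal, Sum.elim_inl, Sum.elim_inr] at this
        exact (mul_eq_zero.1 (by linear_combination -this :
          (r - s) * X (Sum.inr i) (Sum.inl j) = 0)).resolve_left (sub_ne_zero.2 h)
      refine ⟨(X.toBlocks₁₁, X.toBlocks₂₂), ?_⟩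
      ext (i | i) (j | j) <;> simp [f, h12, h21, toBlocks₁₁, toBlocks₂₂]
  rw [← hrange, LinearMap.finrank_range_of_inj hf, Module.finrank_prod, Module.finrank_matrix]
  simp [two_mul]

lemma finrank_centralizer_eq {F A E : Type} [Field F] [Ring A] [Algebra F A] [Field E] [Algebra F E]
    {u : A} {m : ℕ} {r s : E} (h : r ≠ s)
    (Φ : E ⊗[F] A ≃ₐ[E] Matrix (Fin m ⊕ Fin m) (Fin m ⊕ Fin m) E)
    (hΦ : Φ (1 ⊗ₜ u) = Matrix.diagonal (Sum.elim (fun _ => r) (fun _ => s))) :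
    finrank F (LinearMap.ker (LinearMap.mulLeft F u - LinearMap.mulRight F u)) = 2 * (m * m) := by
  have hb : ∀ x : E ⊗[F] A, (LinearMap.mulLeft F u - LinearMap.mulRight F u).baseChange E x =
      1 ⊗ₜ u * x - x * 1 ⊗ₜ u := fun x => by
    induction x using TensorProduct.induction_on with
    | zero => simp
    | tmul c x => simp
    | add x y hx hy => rw [map_add, hx, hy]; noncomm_ring
  have hk : LinearMap.ker
      (LinearMap.mulLeft E (Matrix.diagonal (Sum.elim (fun _ : Fin m => r) (fun _ : Fin m => s))) -
        LinearMap.mulRight E (Matrix.diagonal (Sum.elim (fun _ : Fin m => r) (fun _ : Fin m => s)))) =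
      (LinearMap.ker ((LinearMap.mulLeft F u - LinearMap.mulRight F u).baseChange E)).map
        Φ.toLinearEquiv.toLinearMap := by
    ext x
    obtain ⟨x, rfl⟩ := Φ.surjective x
    rw [Submodule.mem_map_equiv, LinearMap.mem_ker, LinearMap.mem_ker, hb, LinearMap.sub_apply,
      LinearMap.mulLeft_apply, LinearMap.mulRight_apply, ← hΦ, ← map_mul, ← map_mul, ← map_sub,
      map_eq_zero_iff Φ Φ.injective]
    simp
  rw [← finrank_commutant_diagonal m h, hk, LinearEquiv.finrank_map_eq, finrank_ker_baseChange]

end Centralizer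

section Factor
variable {F : Type} [Field F] {V W U : Type} [AddCommGroup V] [Module F V] [AddCommGroup W]
  [Module F W] [AddCommGroup U] [Module F U]

lemma exists_comp_eq_of_ker_le (f : V →ₗ[F] W) (g : V →ₗ[F] U)
    (h : LinearMap.ker f ≤ LinearMap.ker g) : ∃ k : W →ₗ[F] U, ∀ x, g x = k (f x) := by
  obtain ⟨k, hk⟩ := LinearMap.exists_extend
    (((LinearMap.ker f).liftQ g h).comp f.quotKerEquivRange.symm.toLinearMap)
  refine ⟨k, fun x => ?_⟩
  have := LinearMap.congr_fun hk ⟨f x, x, rfl⟩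
  simp only [LinearMap.comp_apply, Submodule.subtype_apply] at this
  rw [this]
  have h2 : f.quotKerEquivRange.symm ⟨f x, x, rfl⟩ = Submodule.Quotient.mk x := by
    rw [LinearEquiv.symm_apply_eq]; rfl
  simp [h2]

end Factor

section Clifford
variable (F : Type) [Field F] (A : Type) [Ring A] [Algebra F A] (T : A →ₗ[F] F)
  (σ : A →ₗ[F] A) (ℓ : A)

/-- The projection of the tensor algebra onto the Clifford algebra. -/
def cliffMk : TensorAlgebra F A →ₐ[F] CliffordAlg F A T σ ℓ :=
  RingQuot.mkAlgHom F (CliffordRel F A T σ ℓ)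

/-- The canonical linear map from `A` to its Clifford algebra. -/
def cliffLin : A →ₗ[F] CliffordAlg F A T σ ℓ :=
  (cliffMk F A T σ ℓ).toLinearMap.comp (TensorAlgebra.ι F)

variable {F A}

lemma cliffLin_of_symm {s : A} (hs : σ s = s) :
    cliffLin F A T σ ℓ s = algebraMap F _ (T (ℓ * s)) := by
  have := RingQuot.mkAlgHom_rel F (CliffordRel.sym (F := F) (T := T) (ℓ := ℓ) s hs)
  exact this.trans (AlgHom.commutes _ _)

lemma cliffLin_eq_top (S : Subalgebra F (CliffordAlg F A T σ ℓ))
    (hS : ∀ x, cliffLin F A T σ ℓ x ∈ S) : S = ⊤ := by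
  rw [eq_top_iff]
  intro y _
  obtain ⟨t, rfl⟩ : ∃ t, cliffMk F A T σ ℓ t = y :=
    RingQuot.mkAlgHom_surjective F (CliffordRel F A T σ ℓ) y
  induction t using TensorAlgebra.induction with
  | algebraMap r => rw [AlgHom.commutes]; exact S.algebraMap_mem r
  | ι x => exact hS x
  | mul x y hx hy => rw [map_mul]; exact S.mul_mem (hx trivial) (hy trivial)
  | add x y hx hy => rw [map_add]; exact S.add_mem (hx trivial) (hy trivial)

lemma exists_cliffLin_eq : ∃ h : A →ₗ[F] CliffordAlg F A T σ ℓ, ∀ x,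
    cliffLin F A T σ ℓ x = T (ℓ * x) • (1 : CliffordAlg F A T σ ℓ) + h (σ x - x) := by
  let g : A →ₗ[F] CliffordAlg F A T σ ℓ := cliffLin F A T σ ℓ -
    (T.comp (LinearMap.mulLeft F ℓ)).smulRight 1
  obtain ⟨h, hh⟩ := exists_comp_eq_of_ker_le (σ - LinearMap.id) g (fun x hx => by
    simp only [LinearMap.mem_ker, LinearMap.sub_apply, LinearMap.id_apply, sub_eq_zero] at hx
    simp [g, cliffLin_of_symm T σ ℓ hx, Algebra.algebraMap_eq_smul_one])
  refine ⟨h, fun x => ?_⟩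
  have := hh x
  simp only [g, LinearMap.sub_apply, LinearMap.smulRight_apply, LinearMap.comp_apply,
    LinearMap.mulLeft_apply, LinearMap.id_apply] at this
  rw [← this]; abel

lemma exists_cliffLin_mul_eq [Module.Finite F A] :
    ∃ (n : ℕ) (b : Fin n → A) (h : Fin n → A →ₗ[F] CliffordAlg F A T σ ℓ), ∀ x y,
    cliffLin F A T σ ℓ x * cliffLin F A T σ ℓ y =
      cliffLin F A T σ ℓ (x * ℓ * y) + ∑ i, h i (x * σ (b i) * y - x * b i * y) := by
  let b := finBasis F A
  let f : A ⊗[F] A →ₗ[F] A →ₗ[F] A := (LinearMap.lcomp F A σ).comp (sand F A) - sand F A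
  let g : A ⊗[F] A →ₗ[F] CliffordAlg F A T σ ℓ :=
    (cliffMk F A T σ ℓ).toLinearMap.comp (mu2 F A) -
      (cliffLin F A T σ ℓ).comp ((LinearMap.applyₗ ℓ).comp (sand F A))
  obtain ⟨k, hk⟩ := exists_comp_eq_of_ker_le f g (fun t ht => by
    have h1 : ∀ x, sand F A t (σ x) = sand F A t x := fun x => by
      have := LinearMap.congr_fun (LinearMap.mem_ker.1 ht) x
      simpa [f, sub_eq_zero] using this
    have := RingQuot.mkAlgHom_rel F (CliffordRel.deg2 (F := F) (T := T) (ℓ := ℓ) t h1)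
    rw [LinearMap.mem_ker]
    exact sub_eq_zero.2 this)
  refine ⟨_, b, fun i => k.comp ((b.coord i).smulRightₗ), fun x y => ?_⟩
  have h1 := hk (x ⊗ₜ y)
  have h2 : g (x ⊗ₜ y) = cliffLin F A T σ ℓ x * cliffLin F A T σ ℓ y -
      cliffLin F A T σ ℓ (x * ℓ * y) := by
    simp [g, mu2, sand, cliffLin]
  rw [h2, sub_eq_iff_eq_add'] at h1
  rw [h1]
  congr 1
  simp only [LinearMap.comp_apply]
  rw [← map_sum]
  congr 1
  refine b.ext fun j => ?_
  simp [f, sand, LinearMap.sum_apply, Finsupp.single_apply, mul_assoc]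

end Clifford

/-- The adjoint of a matrix for the split hyperbolic form. -/
def swapAdj (E : Type) [Field E] (m : ℕ) :
    Matrix (Fin m ⊕ Fin m) (Fin m ⊕ Fin m) E →ₗ[E] Matrix (Fin m ⊕ Fin m) (Fin m ⊕ Fin m) E where
  toFun Y := Y.transpose.submatrix Sum.swap Sum.swap
  map_add' _ _ := rfl
  map_smul' _ _ := rfl

section Frame

variable {F : Type} [Field F] {A : Type} [Ring A] [Algebra F A] (T : A →ₗ[F] F)
  (σ : A →ₗ[F] A) (ℓ : A) {E : Type} [Field E] [Algebra F E] {m : ℕ}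
  (Φ : E ⊗[F] A ≃ₐ[E] Matrix (Fin m ⊕ Fin m) (Fin m ⊕ Fin m) E)

@[simp] lemma swapAdj_apply (Y : Matrix (Fin m ⊕ Fin m) (Fin m ⊕ Fin m) E) (p q) :
    swapAdj E m Y p q = Y q.swap p.swap := rfl

lemma swapAdj_single (p q) (e : E) :
    swapAdj E m (Matrix.single p q e) = Matrix.single q.swap p.swap e := by
  ext r s
  simp only [swapAdj_apply, Matrix.single_apply]
  have h : ∀ a b : Fin m ⊕ Fin m, a = b.swap ↔ a.swap = b := fun a b =>
    ⟨fun h => by rw [h, Sum.swap_swap], fun h => by rw [← h, Sum.swap_swap]⟩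
  simp only [h p s, h q r, and_comm]

/-- The canonical map of the split algebra with quadratic pair to the split Clifford algebra. -/
def splitCliff : Matrix (Fin m ⊕ Fin m) (Fin m ⊕ Fin m) E →ₗ[E] E ⊗[F] CliffordAlg F A T σ ℓ :=
  ((cliffLin F A T σ ℓ).baseChange E).comp Φ.symm.toLinearMap

lemma splitCliff_apply (x : A) :
    splitCliff T σ ℓ Φ (Φ (1 ⊗ₜ x)) = 1 ⊗ₜ cliffLin F A T σ ℓ x := by
  simp [splitCliff]

variable {T σ ℓ Φ}

lemma splitting_induction {P : Matrix (Fin m ⊕ Fin m) (Fin m ⊕ Fin m) E → Prop}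
    (Y) (hsmul : ∀ (e : E) x, P (e • Φ (1 ⊗ₜ x))) (hadd : ∀ X Y, P X → P Y → P (X + Y)) : P Y := by
  obtain ⟨t, rfl⟩ := Φ.surjective Y
  induction t using TensorProduct.induction_on with
  | zero => simpa using hsmul 0 0
  | tmul e x =>
    have := hsmul e x
    rwa [← map_smul, TensorProduct.smul_tmul', smul_eq_mul, mul_one] at this
  | add x y hx hy => rw [map_add]; exact hadd _ _ hx hy

lemma splitCliff_of_adj_eq (hΦσ : ∀ x, Φ (1 ⊗ₜ σ x) = swapAdj E m (Φ (1 ⊗ₜ x)))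
    (hΦT : ∀ x, algebraMap F E (T x) = Matrix.trace (Φ (1 ⊗ₜ x)))
    {Y : Matrix (Fin m ⊕ Fin m) (Fin m ⊕ Fin m) E} (hY : swapAdj E m Y = Y) :
    splitCliff T σ ℓ Φ Y = Matrix.trace (Φ (1 ⊗ₜ ℓ) * Y) • 1 := by
  obtain ⟨h, hh⟩ := exists_cliffLin_eq T σ ℓ
  have key : ∀ Y, splitCliff T σ ℓ Φ Y = Matrix.trace (Φ (1 ⊗ₜ ℓ) * Y) • 1 +
      h.baseChange E (Φ.symm (swapAdj E m Y - Y)) := by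
    intro Y
    induction Y using splitting_induction (Φ := Φ) with
    | hsmul e x =>
      rw [map_smul, map_smul, ← smul_sub, map_smul, map_smul, Matrix.mul_smul, Matrix.trace_smul,
        smul_assoc, ← smul_add, ← hΦσ, ← map_sub, Φ.symm_apply_apply, ← TensorProduct.tmul_sub,
        splitCliff_apply, hh, ← map_mul, Algebra.TensorProduct.tmul_mul_tmul, one_mul, ← hΦT,
        LinearMap.baseChange_tmul, TensorProduct.tmul_add, TensorProduct.tmul_smul,
        algebraMap_smul]
      rfl
    | hadd X Y hX hY =>
      rw [map_add, hX, hY, map_add, Matrix.mul_add, Matrix.trace_add, add_smul, add_sub_add_comm,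
        map_add, map_add]
      abel
  rw [key, hY, sub_self, map_zero, map_zero, add_zero]

lemma exists_splitCliff_mul_eq [Module.Finite F A]
    (hΦσ : ∀ x, Φ (1 ⊗ₜ σ x) = swapAdj E m (Φ (1 ⊗ₜ x))) :
    ∃ (n : ℕ) (Z : Fin n → Matrix (Fin m ⊕ Fin m) (Fin m ⊕ Fin m) E)
      (h : Fin n → Matrix (Fin m ⊕ Fin m) (Fin m ⊕ Fin m) E →ₗ[E] E ⊗[F] CliffordAlg F A T σ ℓ),
      ∀ X Y, splitCliff T σ ℓ Φ X * splitCliff T σ ℓ Φ Y =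
        splitCliff T σ ℓ Φ (X * Φ (1 ⊗ₜ ℓ) * Y) +
          ∑ i, h i (X * swapAdj E m (Z i) * Y - X * Z i * Y) := by
  obtain ⟨n, b, h, hh⟩ := exists_cliffLin_mul_eq T σ ℓ
  refine ⟨n, fun i => Φ (1 ⊗ₜ b i), fun i => ((h i).baseChange E).comp Φ.symm.toLinearMap,
    fun X Y => ?_⟩
  induction X using splitting_induction (Φ := Φ) with
  | hsmul e x =>
    induction Y using splitting_induction (Φ := Φ) with
    | hsmul e' y =>
      simp only [map_smul, smul_mul_assoc, mul_smul_comm, ← smul_sub, ← Finset.smul_sum,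
        ← smul_add]
      congr 2
      simp only [← hΦσ, ← map_mul, ← map_sub, splitCliff_apply, LinearMap.comp_apply,
        AlgEquiv.toLinearMap_apply, Φ.symm_apply_apply, Algebra.TensorProduct.tmul_mul_tmul,
        one_mul, ← TensorProduct.tmul_sub, LinearMap.baseChange_tmul, hh, TensorProduct.tmul_add,
        TensorProduct.tmul_sum]
    | hadd X Y hX hY =>
      simp only [map_add, mul_add, hX, hY, add_sub_add_comm, Finset.sum_add_distrib]
      abel
  | hadd X Y hX hY =>
    simp only [map_add, add_mul, hX, hY, add_sub_add_comm, Finset.sum_add_distrib]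
    abel

end Frame

section Frame

variable {F : Type} [Field F] {A : Type} [Ring A] [Algebra F A] {T : A →ₗ[F] F}
  {σ : A →ₗ[F] A} {ℓ : A} {E : Type} [Field E] [Algebra F E] {m : ℕ}
  {Φ : E ⊗[F] A ≃ₐ[E] Matrix (Fin m ⊕ Fin m) (Fin m ⊕ Fin m) E}

lemma splitCliff_mul_add_mul [Module.Finite F A]
    (hΦσ : ∀ x, Φ (1 ⊗ₜ σ x) = swapAdj E m (Φ (1 ⊗ₜ x)))
    {X X' Y Y' : Matrix (Fin m ⊕ Fin m) (Fin m ⊕ Fin m) E}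
    (h : ∀ Z, X * swapAdj E m Z * Y + X' * swapAdj E m Z * Y' = X * Z * Y + X' * Z * Y') :
    splitCliff T σ ℓ Φ X * splitCliff T σ ℓ Φ Y + splitCliff T σ ℓ Φ X' * splitCliff T σ ℓ Φ Y' =
      splitCliff T σ ℓ Φ (X * Φ (1 ⊗ₜ ℓ) * Y + X' * Φ (1 ⊗ₜ ℓ) * Y') := by
  obtain ⟨n, Z, k, hk⟩ := exists_splitCliff_mul_eq (T := T) (ℓ := ℓ) hΦσ
  have h0 : ∑ i, k i (X * swapAdj E m (Z i) * Y - X * Z i * Y) +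
      ∑ i, k i (X' * swapAdj E m (Z i) * Y' - X' * Z i * Y') = 0 := by
    rw [← Finset.sum_add_distrib]
    refine Finset.sum_eq_zero fun i _ => ?_
    rw [← map_add, ← add_sub_add_comm, h, sub_self, map_zero]
  rw [hk, hk, add_add_add_comm, h0, add_zero, map_add]

lemma splitCliff_mul [Module.Finite F A]
    (hΦσ : ∀ x, Φ (1 ⊗ₜ σ x) = swapAdj E m (Φ (1 ⊗ₜ x)))
    {X Y : Matrix (Fin m ⊕ Fin m) (Fin m ⊕ Fin m) E}
    (h : ∀ Z, X * swapAdj E m Z * Y = X * Z * Y) :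
    splitCliff T σ ℓ Φ X * splitCliff T σ ℓ Φ Y = splitCliff T σ ℓ Φ (X * Φ (1 ⊗ₜ ℓ) * Y) := by
  simpa using splitCliff_mul_add_mul (T := T) (ℓ := ℓ) (X := X) (Y := Y) (X' := 0) (Y' := 0) hΦσ
    (by simpa using h)

variable (T σ ℓ Φ) in
/-- The products of two vectors of the hyperbolic basis in the split Clifford algebra. -/
def cliffCoeff (p q : Fin m ⊕ Fin m) : E ⊗[F] CliffordAlg F A T σ ℓ :=
  splitCliff T σ ℓ Φ (Matrix.single p q.swap 1)

lemma splitCliff_single (p q : Fin m ⊕ Fin m) (e : E) :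
    splitCliff T σ ℓ Φ (Matrix.single p q.swap e) = e • cliffCoeff T σ ℓ Φ p q := by
  rw [cliffCoeff, ← map_smul, Matrix.smul_single, smul_eq_mul, mul_one]

lemma splitCliff_eq_sum (Y : Matrix (Fin m ⊕ Fin m) (Fin m ⊕ Fin m) E) :
    splitCliff T σ ℓ Φ Y = ∑ p, ∑ q : Fin m ⊕ Fin m, Y p q.swap • cliffCoeff T σ ℓ Φ p q := by
  conv_lhs => rw [Matrix.matrix_eq_sum_single Y]
  rw [map_sum]
  refine Finset.sum_congr rfl fun p _ => ?_
  rw [map_sum, ← (Equiv.sumComm (Fin m) (Fin m)).sum_comp]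
  exact Finset.sum_congr rfl fun q _ => splitCliff_single _ _ _

lemma isEvenCliffordSystem_cliffCoeff [Module.Finite F A]
    (hΦσ : ∀ x, Φ (1 ⊗ₜ σ x) = swapAdj E m (Φ (1 ⊗ₜ x)))
    (hΦT : ∀ x, algebraMap F E (T x) = Matrix.trace (Φ (1 ⊗ₜ x)))
    (hL : ∀ p q, Φ (1 ⊗ₜ ℓ) (Sum.swap p) q + Φ (1 ⊗ₜ ℓ) (Sum.swap q) p =
      if p = q.swap then 1 else 0)
    (hL0 : ∀ p, Φ (1 ⊗ₜ ℓ) (Sum.swap p) p = 0) :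
    IsEvenCliffordSystem (E := E) (cliffCoeff T σ ℓ Φ) where
  add_swap p q := by
    rw [cliffCoeff, cliffCoeff, ← map_add, splitCliff_of_adj_eq hΦσ hΦT]
    · rw [Matrix.mul_add, Matrix.trace_add, Matrix.trace_mul_single, Matrix.trace_mul_single]
      simp only [MulOpposite.op_one, one_smul]
      rw [add_comm, hL, ite_smul, one_smul, zero_smul]
    · rw [map_add, swapAdj_single, swapAdj_single, Sum.swap_swap, Sum.swap_swap, add_comm]
  self p := by
    rw [cliffCoeff, splitCliff_of_adj_eq hΦσ hΦT, Matrix.trace_mul_single, hL0]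
    · simp
    · rw [swapAdj_single, Sum.swap_swap]
  mul_add_mul p q r s := by
    rw [cliffCoeff, cliffCoeff, cliffCoeff, cliffCoeff, splitCliff_mul_add_mul hΦσ]
    · simp only [Matrix.single_mul_mul_single, one_mul, mul_one]
      rw [← Matrix.single_add, splitCliff_single, hL, ite_smul, one_smul, zero_smul]
    · intro Z
      simp only [Matrix.single_mul_mul_single, one_mul, mul_one, swapAdj_apply, Sum.swap_swap]
      rw [add_comm]
  mul_self p q s := by
    rw [cliffCoeff, cliffCoeff, splitCliff_mul hΦσ]
    · simp only [Matrix.single_mul_mul_single, one_mul, mul_one]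
      rw [splitCliff_single, hL0, zero_smul]
    · intro Z
      simp only [Matrix.single_mul_mul_single, one_mul, mul_one, swapAdj_apply, Sum.swap_swap]
  gen S hS := by
    have h1 : ∀ Y, splitCliff T σ ℓ Φ Y ∈ S := fun Y => by
      rw [splitCliff_eq_sum]
      exact S.sum_mem fun p _ => S.sum_mem fun q _ => S.smul_mem (hS p q) _
    have h2 := cliffLin_eq_top T σ ℓ
      ((S.restrictScalars F).comap Algebra.TensorProduct.includeRight) (fun x => by
        have := h1 (Φ (1 ⊗ₜ x))
        rwa [splitCliff_apply] at this)
    rw [eq_top_iff]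
    intro t _
    induction t using TensorProduct.induction_on with
    | zero => exact S.zero_mem
    | tmul e x =>
      have hx : x ∈ (S.restrictScalars F).comap Algebra.TensorProduct.includeRight := by
        rw [h2]; trivial
      have := S.smul_mem (show (1 : E) ⊗ₜ[F] x ∈ S from hx) e
      rwa [TensorProduct.smul_tmul', smul_eq_mul, mul_one] at this
    | add x y hx hy => exact S.add_mem (hx trivial) (hy trivial)

lemma FockModel.sum_smul_op_mul_op (M : FockModel E m) (W β : Fin m ⊕ Fin m → Fin m ⊕ Fin m → E)
    (hW : ∀ p q, W p q = W q p) (hβ : ∀ p q, β p q + β q p = if p = q.swap then 1 else 0)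
    (hβ0 : ∀ p, β p p = 0) :
    ∑ p, ∑ q, W p q • (M.op p * M.op q) = (∑ p, ∑ q, W p q * β p q) • 1 := by
  rw [← sub_eq_zero, Finset.sum_smul, ← Finset.sum_sub_distrib]
  simp only [Finset.sum_smul, ← Finset.sum_sub_distrib, mul_smul, ← smul_sub]
  refine sum_sum_eq_zero_of_alternating _ _ (fun p q => ?_) (fun p => ?_)
  · have := congrArg (fun e : E => e • (1 : Matrix M.J M.J E)) (hβ p q)
    simp only [add_smul, ite_smul, one_smul, zero_smul] at this
    rw [hW q p, ← smul_add, sub_add_sub_comm, M.op_mul_add, this, sub_self, smul_zero]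
  · rw [M.op_sq, hβ0, zero_smul, sub_self, smul_zero]

/-- The degree-one part of the spin representation. -/
def FockModel.cliffMap (M : FockModel E m) :
    Matrix (Fin m ⊕ Fin m) (Fin m ⊕ Fin m) E →ₗ[E] Matrix M.J M.J E where
  toFun Y := ∑ p, ∑ q : Fin m ⊕ Fin m, Y p q.swap • (M.op p * M.op q)
  map_add' X Y := by simp only [Matrix.add_apply, add_smul, Finset.sum_add_distrib]
  map_smul' e Y := by simp only [Matrix.smul_apply, smul_eq_mul, mul_smul, Finset.smul_sum,
    RingHom.id_apply]

end Frame

section Spin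

variable {F : Type} [Field F] {A : Type} [Ring A] [Algebra F A] {T : A →ₗ[F] F}
  {σ : A →ₗ[F] A} {ℓ : A} {E : Type} [Field E] [Algebra F E] {m : ℕ}
  {Φ : E ⊗[F] A ≃ₐ[E] Matrix (Fin m ⊕ Fin m) (Fin m ⊕ Fin m) E}

lemma FockModel.cliffMap_apply (M : FockModel E m) (Y) :
    M.cliffMap Y = ∑ p, ∑ q : Fin m ⊕ Fin m, Y p q.swap • (M.op p * M.op q) := rfl

lemma FockModel.cliffMap_single (M : FockModel E m) (p q : Fin m ⊕ Fin m) :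
    M.cliffMap (Matrix.single p q.swap 1) = M.op p * M.op q := by
  rw [cliffMap_apply, Finset.sum_eq_single p, Finset.sum_eq_single q]
  · simp
  · intro b _ hb
    rw [Matrix.single_apply_of_col_ne _ _ (fun h => hb ?_), zero_smul]
    rw [← Sum.swap_swap b, ← h, Sum.swap_swap]
  · simp
  · intro b _ hb
    exact Finset.sum_eq_zero fun q _ => by rw [Matrix.single_apply_of_row_ne hb.symm, zero_smul]
  · simp

variable (Φ) in
/-- The coordinates of a tensor in `A ⊗ A` in a splitting of `A`. -/
def tensorCoord (p s : Fin m ⊕ Fin m) :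
    A ⊗[F] A →ₗ[F] (Fin m ⊕ Fin m → Fin m ⊕ Fin m → E) :=
  TensorProduct.lift (LinearMap.mk₂ F
    (fun a b q r => Φ (1 ⊗ₜ a) p q.swap * Φ (1 ⊗ₜ b) r s)
    (fun a a' b => by ext; simp [TensorProduct.tmul_add, add_mul])
    (fun c a b => by
      ext
      rw [TensorProduct.tmul_smul, ← algebraMap_smul E c, map_smul]
      simp [Algebra.smul_def, mul_assoc])
    (fun a b b' => by ext; simp [TensorProduct.tmul_add, mul_add])
    (fun c a b => by
      ext
      rw [TensorProduct.tmul_smul, ← algebraMap_smul E c, map_smul]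
      simp [Algebra.smul_def, mul_left_comm]))

lemma tensorCoord_tmul (p s q r : Fin m ⊕ Fin m) (a b : A) :
    tensorCoord Φ p s (a ⊗ₜ b) q r = Φ (1 ⊗ₜ a) p q.swap * Φ (1 ⊗ₜ b) r s := rfl

lemma splitting_sand (t : A ⊗[F] A) (x : A) (p s : Fin m ⊕ Fin m) :
    Φ (1 ⊗ₜ sand F A t x) p s =
      ∑ q, ∑ r : Fin m ⊕ Fin m, tensorCoord Φ p s t q r * Φ (1 ⊗ₜ x) q.swap r := by
  induction t using TensorProduct.induction_on with
  | zero => simp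
  | tmul a b =>
    have h : (1 : E) ⊗ₜ[F] (sand F A (a ⊗ₜ b) x) = (1 ⊗ₜ a) * (1 ⊗ₜ x) * (1 ⊗ₜ b) := by
      simp [sand]
    rw [h, map_mul, map_mul, Matrix.mul_apply, Finset.sum_comm]
    refine Finset.sum_congr rfl fun r _ => ?_
    rw [Matrix.mul_apply, Finset.sum_mul, ← (Equiv.sumComm (Fin m) (Fin m)).sum_comp]
    refine Finset.sum_congr rfl fun q _ => ?_
    rw [tensorCoord_tmul, Equiv.sumComm_apply, mul_right_comm]
  | add t t' h h' =>
    simp only [map_add, LinearMap.add_apply, TensorProduct.tmul_add, Matrix.add_apply, h, h',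
      Pi.add_apply, add_mul, Finset.sum_add_distrib]

lemma tensorCoord_comm (hΦσ : ∀ x, Φ (1 ⊗ₜ σ x) = swapAdj E m (Φ (1 ⊗ₜ x)))
    {t : A ⊗[F] A} (ht : ∀ x, sand F A t (σ x) = sand F A t x) (p s q r : Fin m ⊕ Fin m) :
    tensorCoord Φ p s t q r = tensorCoord Φ p s t r q := by
  have key : ∀ Z : Matrix (Fin m ⊕ Fin m) (Fin m ⊕ Fin m) E,
      ∑ q, ∑ r : Fin m ⊕ Fin m, tensorCoord Φ p s t q r * swapAdj E m Z q.swap r =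
        ∑ q, ∑ r : Fin m ⊕ Fin m, tensorCoord Φ p s t q r * Z q.swap r := by
    intro Z
    induction Z using splitting_induction (Φ := Φ) with
    | hsmul e x =>
      simp only [map_smul, ← hΦσ, Matrix.smul_apply, smul_eq_mul, mul_left_comm _ e,
        ← Finset.mul_sum, ← splitting_sand, ht]
    | hadd X Y hX hY =>
      simp only [map_add, Matrix.add_apply, mul_add, Finset.sum_add_distrib, hX, hY]
  have h := key (Matrix.single q.swap r 1)
  have e : ∀ (W : Fin m ⊕ Fin m → Fin m ⊕ Fin m → E) (q r : Fin m ⊕ Fin m),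
      ∑ a, ∑ b : Fin m ⊕ Fin m, W a b * Matrix.single q.swap r 1 a.swap b = W q r := by
    intro W q r
    rw [Finset.sum_eq_single q, Finset.sum_eq_single r]
    · simp
    · intro b _ hb
      rw [Matrix.single_apply_of_col_ne _ _ hb.symm, mul_zero]
    · simp
    · intro b _ hb
      refine Finset.sum_eq_zero fun r _ => ?_
      rw [Matrix.single_apply_of_row_ne (fun h => hb ?_), mul_zero]
      rw [← Sum.swap_swap b, ← h, Sum.swap_swap]
    · simp
  rw [swapAdj_single, Sum.swap_swap, e, e] at h
  exact h.symm

variable (Φ) in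
/-- The spin representation on degree-one elements. -/
def FockModel.degreeOne (M : FockModel E m) : A →ₗ[F] Matrix M.J M.J E :=
  (M.cliffMap.restrictScalars F).comp
    (Φ.toLinearMap.restrictScalars F ∘ₗ (TensorProduct.mk F E A 1))

lemma FockModel.degreeOne_apply (M : FockModel E m) (x : A) :
    M.degreeOne Φ x = M.cliffMap (Φ (1 ⊗ₜ x)) := rfl

lemma FockModel.lift_mu2 (M : FockModel E m) (t : A ⊗[F] A) :
    TensorAlgebra.lift F (M.degreeOne Φ) (mu2 F A t) = ∑ p, ∑ s : Fin m ⊕ Fin m,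
      M.op p * (∑ q, ∑ r, tensorCoord Φ p s.swap t q r • (M.op q * M.op r)) * M.op s := by
  induction t using TensorProduct.induction_on with
  | zero => simp
  | tmul a b =>
    have h : mu2 F A (a ⊗ₜ b) = TensorAlgebra.ι F a * TensorAlgebra.ι F b := by simp [mu2]
    rw [h, map_mul, TensorAlgebra.lift_ι_apply, TensorAlgebra.lift_ι_apply, M.degreeOne_apply,
      M.degreeOne_apply, M.cliffMap_apply, M.cliffMap_apply, Finset.sum_mul]
    refine Finset.sum_congr rfl fun p _ => ?_
    simp only [tensorCoord_tmul, Finset.sum_mul, Finset.mul_sum]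
    rw [Finset.sum_comm (s := Finset.univ (α := Fin m ⊕ Fin m))]
    refine Finset.sum_congr rfl fun q _ => ?_
    rw [Finset.sum_comm]
    refine Finset.sum_congr rfl fun r _ => Finset.sum_congr rfl fun s _ => ?_
    simp only [smul_mul_assoc, mul_smul_comm, smul_smul, mul_assoc]
    congr 1
    exact mul_comm _ _
  | add t t' h h' =>
    simp only [map_add, h, h', Pi.add_apply, add_smul, Finset.sum_add_distrib, mul_add, add_mul]

lemma FockModel.exists_algHom (M : FockModel E m)
    (hΦσ : ∀ x, Φ (1 ⊗ₜ σ x) = swapAdj E m (Φ (1 ⊗ₜ x)))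
    (hΦT : ∀ x, algebraMap F E (T x) = Matrix.trace (Φ (1 ⊗ₜ x)))
    (hL : ∀ p q, Φ (1 ⊗ₜ ℓ) (Sum.swap p) q + Φ (1 ⊗ₜ ℓ) (Sum.swap q) p =
      if p = q.swap then 1 else 0)
    (hL0 : ∀ p, Φ (1 ⊗ₜ ℓ) (Sum.swap p) p = 0) :
    ∃ ρ : E ⊗[F] CliffordAlg F A T σ ℓ →ₐ[E] Matrix M.J M.J E,
      ∀ p q, ρ (cliffCoeff T σ ℓ Φ p q) = M.op p * M.op q := by
  have hrel : ∀ ⦃x y⦄, CliffordRel F A T σ ℓ x y →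
      TensorAlgebra.lift F (M.degreeOne Φ) x = TensorAlgebra.lift F (M.degreeOne Φ) y := by
    rintro _ _ (⟨s, hs⟩ | ⟨t, ht⟩)
    · rw [TensorAlgebra.lift_ι_apply, AlgHom.commutes, M.degreeOne_apply, M.cliffMap_apply]
      rw [M.sum_smul_op_mul_op _ (fun p q => Φ (1 ⊗ₜ ℓ) (Sum.swap p) q) _ hL hL0]
      · rw [IsScalarTower.algebraMap_apply F E, hΦT, Algebra.algebraMap_eq_smul_one]
        congr 1
        have h : (1 : E) ⊗ₜ[F] (ℓ * s) = (1 ⊗ₜ ℓ) * (1 ⊗ₜ s) := by simp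
        rw [h, map_mul, Matrix.trace, ← (Equiv.sumComm (Fin m) (Fin m)).sum_comp]
        simp only [Matrix.diag_apply, Matrix.mul_apply]
        refine Finset.sum_congr rfl fun p _ => Finset.sum_congr rfl fun q _ => ?_
        conv_lhs => rw [← hs, hΦσ, swapAdj_apply, Sum.swap_swap]
        rw [mul_comm, Equiv.sumComm_apply, Sum.swap_swap]
      · intro p q
        have := congrFun (congrFun (hΦσ s) p) q.swap
        rwa [hs, swapAdj_apply, Sum.swap_swap] at this
    · rw [M.lift_mu2, TensorAlgebra.lift_ι_apply, M.degreeOne_apply, M.cliffMap_apply]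
      refine Finset.sum_congr rfl fun p _ => Finset.sum_congr rfl fun s _ => ?_
      rw [M.sum_smul_op_mul_op _ (fun p q => Φ (1 ⊗ₜ ℓ) (Sum.swap p) q)
        (tensorCoord_comm hΦσ ht p s.swap) hL hL0, splitting_sand, mul_smul_comm, mul_one,
        smul_mul_assoc]
  let ρ₀ : CliffordAlg F A T σ ℓ →ₐ[F] Matrix M.J M.J E :=
    RingQuot.liftAlgHom F ⟨TensorAlgebra.lift F (M.degreeOne Φ), hrel⟩
  have hρ₀ : ∀ x, ρ₀ (cliffLin F A T σ ℓ x) = M.degreeOne Φ x := fun x => by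
    refine (RingQuot.liftAlgHom_mkAlgHom_apply F _ hrel _).trans ?_
    rw [TensorAlgebra.lift_ι_apply]
  let ρ : E ⊗[F] CliffordAlg F A T σ ℓ →ₐ[E] Matrix M.J M.J E :=
    Algebra.TensorProduct.lift (Algebra.ofId E _) ρ₀ (fun e x => Algebra.commutes e _)
  have hρ₁ : ∀ x, ρ (1 ⊗ₜ x) = ρ₀ x := fun x =>
    (Algebra.TensorProduct.lift_tmul _ _ _ _ _).trans (by rw [map_one, one_mul])
  have hρ : ∀ Y, ρ (splitCliff T σ ℓ Φ Y) = M.cliffMap Y := by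
    intro Y
    induction Y using splitting_induction (Φ := Φ) with
    | hsmul e x =>
      rw [map_smul, map_smul, map_smul, splitCliff_apply, hρ₁, hρ₀, M.degreeOne_apply]
    | hadd X Y hX hY => rw [map_add, map_add, map_add, hX, hY]
  exact ⟨ρ, fun p q => by rw [cliffCoeff, hρ, M.cliffMap_single]⟩

end Spin

section Descent

variable {F : Type} [Field F] {E : Type} [Field E] [Algebra F E] {B : Type} [Ring B] [Algebra F B]

variable (B) in
/-- Contraction of a scalar extension by a linear functional. -/
def contract (r : E →ₗ[F] F) : E ⊗[F] B →ₗ[F] B :=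
  (TensorProduct.lid F B).toLinearMap.comp (r.rTensor B)

@[simp] lemma contract_tmul (r : E →ₗ[F] F) (e : E) (b : B) :
    contract B r (e ⊗ₜ b) = r e • b := by simp [contract]

lemma contract_mul_right (r : E →ₗ[F] F) (b : B) (X : E ⊗[F] B) :
    contract B r ((1 ⊗ₜ b) * X) = b * contract B r X := by
  induction X using TensorProduct.induction_on with
  | zero => simp
  | tmul e x => simp
  | add X Y hX hY => simp only [mul_add, map_add, hX, hY]

lemma contract_mul_left (r : E →ₗ[F] F) (b : B) (X : E ⊗[F] B) :
    contract B r (X * (1 ⊗ₜ b)) = contract B r X * b := by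
  induction X using TensorProduct.induction_on with
  | zero => simp
  | tmul e x => simp
  | add X Y hX hY => simp only [add_mul, map_add, hX, hY]

lemma eq_zero_of_forall_contract {X : E ⊗[F] B} (h : ∀ r : E →ₗ[F] F, contract B r X = 0) :
    X = 0 := by
  classical
  let b := Basis.ofVectorSpace F E
  apply (TensorProduct.equivFinsuppOfBasisLeft (N := B) b).injective
  rw [map_zero]
  ext i
  rw [TensorProduct.equivFinsuppOfBasisLeft_apply]
  exact h (b.coord i)

lemma exists_dual_one_eq_one (F E : Type) [Field F] [Field E] [Algebra F E] :
    ∃ r : E →ₗ[F] F, r 1 = 1 := by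
  obtain ⟨r, hr⟩ := (Algebra.linearMap F E).exists_leftInverse_of_injective
    (LinearMap.ker_eq_bot.2 (algebraMap F E).injective)
  exact ⟨r, by simpa using LinearMap.congr_fun hr 1⟩

lemma one_tmul_mul_comm {w : B} (hw : ∀ b, w * b = b * w) (X : E ⊗[F] B) :
    ((1 : E) ⊗ₜ[F] w) * X = X * (1 ⊗ₜ w) := by
  induction X using TensorProduct.induction_on with
  | zero => simp
  | tmul e x => simp [hw]
  | add X Y hX hY => simp only [add_mul, mul_add, hX, hY]

/-- Descent of a quadratic étale center: if the center of `E ⊗ B` is spanned by `1` and an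
element `z` acting by `1` and `0` on two conjugate nonzero spaces cut out by equations defined
over `F`, then the center of `B` is spanned by `1` and a root of `X ^ 2 - X - a`. -/
theorem exists_center_generator {a : F} {r : E} (hr : r * r = r + algebraMap F E a)
    (hr2 : 2 * r - 1 ≠ 0) {Y : Type} (c d : Y → B) (z : E ⊗[F] B)
    (hz : ∀ X, z * X = X * z)
    (hspan : ∀ X : E ⊗[F] B, (∀ Y, X * Y = Y * X) → ∃ α β : E, X = α • 1 + β • z)
    (h₁ : ∀ X : E ⊗[F] B, (∀ y, (1 ⊗ₜ d y) * X = (1 - r) • ((1 ⊗ₜ c y) * X)) → z * X = X)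
    (h₁' : ∃ X : E ⊗[F] B, X ≠ 0 ∧ ∀ y, (1 ⊗ₜ d y) * X = (1 - r) • ((1 ⊗ₜ c y) * X))
    (h₀ : ∀ X : E ⊗[F] B, (∀ y, (1 ⊗ₜ d y) * X = r • ((1 ⊗ₜ c y) * X)) → z * X = 0)
    (h₀' : ∃ X : E ⊗[F] B, X ≠ 0 ∧ ∀ y, (1 ⊗ₜ d y) * X = r • ((1 ⊗ₜ c y) * X)) :
    ∃ w : B, (∀ b, w * b = b * w) ∧ w * w = w + a • 1 ∧
      (∀ b, (∀ b', b * b' = b' * b) → ∃ α β : F, b = α • 1 + β • w) ∧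
      ∀ α : F, w ≠ α • 1 := by
  obtain ⟨s, hs⟩ := exists_dual_one_eq_one F E
  obtain ⟨X₁, hX₁, hX₁'⟩ := h₁'
  obtain ⟨X₀, hX₀, hX₀'⟩ := h₀'
  have hz₁ := h₁ X₁ hX₁'
  have hz₀ := h₀ X₀ hX₀'
  have hra : algebraMap F E a = r * r - r := by rw [hr]; ring
  let wE : E ⊗[F] B := (1 - r) • 1 + (2 * r - 1) • z
  have hD : ∀ t t' : B, (∀ y, d y * t = c y * (t - t')) → (∀ y, d y * t' = - a • (c y * t)) →
      wE * (1 ⊗ₜ t) = 1 ⊗ₜ t' := by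
    intro t t' h h'
    have e1 : ∀ y, ((1 : E) ⊗ₜ[F] d y) * (1 ⊗ₜ t) =
        (1 ⊗ₜ c y) * (1 ⊗ₜ t) - (1 ⊗ₜ c y) * (1 ⊗ₜ t') := fun y => by
      simp only [Algebra.TensorProduct.tmul_mul_tmul, mul_one, h, mul_sub, TensorProduct.tmul_sub]
    have e2 : ∀ y, ((1 : E) ⊗ₜ[F] d y) * (1 ⊗ₜ t') =
        (r - r * r) • ((1 ⊗ₜ c y) * (1 ⊗ₜ t)) := fun y => by
      simp only [Algebra.TensorProduct.tmul_mul_tmul, mul_one, h', TensorProduct.tmul_smul]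
      rw [← algebraMap_smul E, map_neg, hra, neg_sub]
    have k1 := h₁ (1 ⊗ₜ t' - (1 - r) • 1 ⊗ₜ t) (fun y => by
      simp only [mul_sub, mul_smul_comm, e1, e2]; module)
    have k0 := h₀ (1 ⊗ₜ t' - r • 1 ⊗ₜ t) (fun y => by
      simp only [mul_sub, mul_smul_comm, e1, e2]; module)
    rw [mul_sub, mul_smul_comm] at k0 k1
    simp only [wE, add_mul, smul_mul_assoc, one_mul]
    have : (2 * r - 1) • (z * (1 : E) ⊗ₜ[F] t) =
      (z * 1 ⊗ₜ t' - (1 - r) • (z * 1 ⊗ₜ t)) - (z * 1 ⊗ₜ t' - r • (z * 1 ⊗ₜ t)) := by module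
    rw [this, k1, k0]
    module
  let w : B := contract B s wE
  have hwE : ∀ X, wE * X = X * wE := fun X => by
    simp only [wE, add_mul, mul_add, smul_mul_assoc, mul_smul_comm, hz, one_mul, mul_one]
  have hw : ∀ b, w * b = b * w := fun b => by
    rw [← contract_mul_left, hwE, contract_mul_right]
  have hwD : ∀ t t' : B, (∀ y, d y * t = c y * (t - t')) → (∀ y, d y * t' = - a • (c y * t)) →
      w * t = t' := fun t t' h h' => by
    rw [← contract_mul_left, hD t t' h h', contract_tmul, hs, one_smul]
  have hact : ∀ (q : E) (X : E ⊗[F] B), q * (1 - q) = - algebraMap F E a →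
      (∀ y, (1 ⊗ₜ d y) * X = (1 - q) • ((1 ⊗ₜ c y) * X)) → (1 ⊗ₜ w) * X = q • X := by
    intro q X hq hX
    rw [← sub_eq_zero]
    refine eq_zero_of_forall_contract fun s => ?_
    rw [map_sub, contract_mul_right, sub_eq_zero]
    refine hwD _ _ (fun y => ?_) (fun y => ?_)
    · rw [← map_sub, ← contract_mul_right, hX, ← contract_mul_right]
      congr 1
      rw [mul_sub, mul_smul_comm]; module
    · rw [← contract_mul_right, ← contract_mul_right, mul_smul_comm, hX, smul_smul, hq,
        ← map_neg, algebraMap_smul, map_smul]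
  have hw₁ := hact r X₁ (by rw [hra]; ring) hX₁'
  have hw₀ := hact (1 - r) X₀ (by rw [hra]; ring) (by simpa using hX₀')
  have hcoef : ∀ (α β γ : E) (X : E ⊗[F] B), X ≠ 0 → α • X + β • X = γ • X → α + β = γ :=
    fun α β γ X hX h => smul_left_injective E hX (by simpa only [add_smul] using h)
  have hwEq : (1 : E) ⊗ₜ[F] w = wE := by
    obtain ⟨α, β, h⟩ := hspan _ (one_tmul_mul_comm hw)
    have q1 : α + β = r := hcoef _ _ _ X₁ hX₁ (by
      rw [← hw₁, h, add_mul, smul_mul_assoc, smul_mul_assoc, hz₁, one_mul])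
    have q0 : α + 0 = 1 - r := hcoef _ _ _ X₀ hX₀ (by
      rw [← hw₀, h, add_mul, smul_mul_assoc, smul_mul_assoc, hz₀, one_mul]; simp)
    have hα : α = 1 - r := by simpa using q0
    have hβ : β = 2 * r - 1 := by rw [hα] at q1; linear_combination q1
    rw [h, hα, hβ]
  have hzz : z * z = z := by
    obtain ⟨α, β, h⟩ := hspan (z * z) (fun Y => by
      rw [mul_assoc, hz Y, ← mul_assoc, hz Y, mul_assoc])
    have q1 : α + β = 1 := hcoef _ _ _ X₁ hX₁ (by
      conv_rhs => rw [one_smul, ← hz₁, ← hz₁, ← mul_assoc, h]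
      rw [add_mul, smul_mul_assoc, smul_mul_assoc, hz₁, one_mul])
    have q0 : α • X₀ = 0 := by
      have : z * z * X₀ = 0 := by rw [mul_assoc, hz₀, mul_zero]
      rwa [h, add_mul, smul_mul_assoc, smul_mul_assoc, hz₀, one_mul, smul_zero, add_zero] at this
    have hα : α = 0 := (smul_eq_zero.1 q0).resolve_right hX₀
    rw [h, hα, show β = 1 by simpa [hα] using q1]; simp
  have hinj : ∀ x y : B, (1 : E) ⊗ₜ[F] x = 1 ⊗ₜ y → x = y := fun x y h => by
    simpa [hs] using congrArg (contract B s) h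
  refine ⟨w, hw, hinj _ _ ?_, fun b hb => ?_, fun α h => hr2 ?_⟩
  · have : (1 : E) ⊗ₜ[F] (w * w) = (1 ⊗ₜ w) * (1 ⊗ₜ w) := by simp
    rw [this, TensorProduct.tmul_add, TensorProduct.tmul_smul, ← algebraMap_smul E a, hra, hwEq]
    simp only [wE, add_mul, mul_add, smul_mul_assoc, mul_smul_comm, hzz, one_mul, mul_one,
      ← Algebra.TensorProduct.one_def]
    module
  · obtain ⟨α, β, h⟩ := hspan _ (one_tmul_mul_comm (E := E) hb)
    have h2 : (1 : E) ⊗ₜ[F] b = (α - β * (2 * r - 1)⁻¹ * (1 - r)) • (1 ⊗ₜ 1) +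
        (β * (2 * r - 1)⁻¹) • (1 ⊗ₜ w) := by
      rw [hwEq, h, ← Algebra.TensorProduct.one_def]
      simp only [wE, smul_add, smul_smul]
      rw [mul_assoc β _ (2 * r - 1), inv_mul_cancel₀ hr2]
      module
    have h3 := congrArg (contract B s) h2
    simp only [map_add, TensorProduct.smul_tmul', smul_eq_mul, mul_one, contract_tmul, hs,
      one_smul] at h3
    exact ⟨_, _, h3⟩
  · have e : ∀ X : E ⊗[F] B, (1 ⊗ₜ w) * X = algebraMap F E α • X := fun X => by
      rw [h, TensorProduct.tmul_smul, smul_mul_assoc, ← Algebra.TensorProduct.one_def, one_mul,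
        algebraMap_smul]
    have q1 : algebraMap F E α = r := smul_left_injective E hX₁ ((e X₁).symm.trans hw₁)
    have q0 : algebraMap F E α = 1 - r := smul_left_injective E hX₀ ((e X₀).symm.trans hw₀)
    linear_combination q0 - q1

end Descent

section Final

lemma nonempty_quadraticAlgebra_algEquiv {F S : Type} [Field F] [Ring S] [Algebra F S] {a : F}
    {u : S} (hu : u * u = u + a • 1) (hspan : ∀ s : S, ∃ α β : F, s = α • 1 + β • u)
    (hne : ∀ α : F, u ≠ α • 1) : Nonempty (QuadraticAlgebra F a 1 ≃ₐ[F] S) := by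
  have : Nontrivial S := ⟨u, _, hne 0⟩
  let f := QuadraticAlgebra.lift (a := a) (b := (1 : F)) ⟨u, by rw [hu, one_smul, add_comm]⟩
  have hf : ∀ z, f z = z.re • (1 : S) + z.im • u := fun _ => rfl
  refine ⟨AlgEquiv.ofBijective f ⟨?_, fun s => ?_⟩⟩
  · rw [injective_iff_map_eq_zero]
    intro z hz
    rw [hf] at hz
    have him : z.im = 0 := by
      by_contra h
      refine hne (-(z.im⁻¹ * z.re)) ?_
      have h2 : z.im • u = -(z.re • (1 : S)) := eq_neg_of_add_eq_zero_right hz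
      rw [← inv_smul_smul₀ h u, h2, smul_neg, smul_smul, neg_smul]
    rw [him, zero_smul, add_zero] at hz
    exact QuadraticAlgebra.ext ((smul_eq_zero.1 hz).resolve_right one_ne_zero) him
  · obtain ⟨α, β, rfl⟩ := hspan s
    exact ⟨⟨α, β⟩, hf _⟩

variable {F : Type} [Field F] {A : Type} [Ring A] [Algebra F A] {T : A →ₗ[F] F}
  {σ : A →ₗ[F] A} {ℓ ℓ' u : A} {E : Type} [Field E] [Algebra F E] {m : ℕ}
  {Φ : E ⊗[F] A ≃ₐ[E] Matrix (Fin m ⊕ Fin m) (Fin m ⊕ Fin m) E}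

lemma splitting_add_swap (hΦσ : ∀ x, Φ (1 ⊗ₜ σ x) = swapAdj E m (Φ (1 ⊗ₜ x)))
    (hℓ : ℓ + σ ℓ = 1) (p q : Fin m ⊕ Fin m) :
    Φ (1 ⊗ₜ ℓ) p.swap q + Φ (1 ⊗ₜ ℓ) q.swap p = if p = q.swap then 1 else 0 := by
  have h : Φ (1 ⊗ₜ ℓ) + swapAdj E m (Φ (1 ⊗ₜ ℓ)) = 1 := by
    rw [← hΦσ, ← map_add, ← TensorProduct.tmul_add, hℓ, ← Algebra.TensorProduct.one_def, map_one]
  have := congrFun (congrFun h p.swap) q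
  rw [Matrix.add_apply, swapAdj_apply, Sum.swap_swap, Matrix.one_apply] at this
  rw [this]
  congr 1
  exact propext ⟨fun h => by rw [← h, Sum.swap_swap], fun h => by rw [h, Sum.swap_swap]⟩

lemma trace_splitting_mul_eq (hΦσ : ∀ x, Φ (1 ⊗ₜ σ x) = swapAdj E m (Φ (1 ⊗ₜ x)))
    (hΦT : ∀ x, algebraMap F E (T x) = Matrix.trace (Φ (1 ⊗ₜ x)))
    (hℓ : ∀ s, σ s = s → T (ℓ * s) = T (ℓ' * s))
    {Y : Matrix (Fin m ⊕ Fin m) (Fin m ⊕ Fin m) E} (hY : swapAdj E m Y = Y) :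
    Matrix.trace (Φ (1 ⊗ₜ ℓ) * Y) = Matrix.trace (Φ (1 ⊗ₜ ℓ') * Y) := by
  obtain ⟨k, hk⟩ := exists_comp_eq_of_ker_le (σ - LinearMap.id)
    (T.comp (LinearMap.mulLeft F (ℓ - ℓ'))) (fun x hx => by
      simp only [LinearMap.mem_ker, LinearMap.sub_apply, LinearMap.id_apply, sub_eq_zero] at hx
      simp [sub_mul, hℓ x hx])
  have key : ∀ Y, Matrix.trace (Φ (1 ⊗ₜ (ℓ - ℓ')) * Y) =
      Algebra.TensorProduct.rid F E E (k.baseChange E (Φ.symm (swapAdj E m Y - Y))) := by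
    intro Y
    induction Y using splitting_induction (Φ := Φ) with
    | hsmul e x =>
      have h := hk x
      simp only [LinearMap.comp_apply, LinearMap.mulLeft_apply, LinearMap.sub_apply,
        LinearMap.id_apply] at h
      rw [map_smul, ← hΦσ, ← smul_sub, ← map_sub, ← TensorProduct.tmul_sub, map_smul, map_smul,
        map_smul, Φ.symm_apply_apply, LinearMap.baseChange_tmul, ← h, Matrix.mul_smul,
        Matrix.trace_smul, ← map_mul, Algebra.TensorProduct.tmul_mul_tmul, one_mul, ← hΦT]
      simp [Algebra.smul_def]
    | hadd X Y hX hY =>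
      rw [Matrix.mul_add, Matrix.trace_add, hX, hY, map_add, add_sub_add_comm]
      simp only [map_add]
  have := key Y
  rw [hY, sub_self, map_zero, map_zero, map_zero, TensorProduct.tmul_sub, map_sub, Matrix.sub_mul,
    Matrix.trace_sub, sub_eq_zero] at this
  exact this

lemma splitting_adjoin_eq_diagonal {v : Fin m ⊕ Fin m → E}
    (hu : Φ (1 ⊗ₜ u) = Matrix.diagonal v) {x : A} (hx : x ∈ Algebra.adjoin F {u}) :
    ∃ d, Φ (1 ⊗ₜ x) = Matrix.diagonal d := by
  induction hx using Algebra.adjoin_induction with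
  | mem x hx => rw [Set.mem_singleton_iff.1 hx]; exact ⟨_, hu⟩
  | algebraMap c =>
    refine ⟨fun _ => algebraMap F E c, ?_⟩
    rw [Algebra.algebraMap_eq_smul_one, TensorProduct.tmul_smul, ← algebraMap_smul E c, map_smul,
      ← Algebra.TensorProduct.one_def, map_one, ← Matrix.diagonal_one, ← Matrix.diagonal_smul]
    congr 1; ext; simp
  | add x y _ _ hx hy =>
    obtain ⟨d, hd⟩ := hx
    obtain ⟨d', hd'⟩ := hy
    exact ⟨_, by rw [TensorProduct.tmul_add, map_add, hd, hd', Matrix.diagonal_add]⟩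
  | mul x y _ _ hx hy =>
    obtain ⟨d, hd⟩ := hx
    obtain ⟨d', hd'⟩ := hy
    have h : (1 : E) ⊗ₜ[F] (x * y) = (1 ⊗ₜ x) * (1 ⊗ₜ y) := by simp
    exact ⟨_, by rw [h, map_mul, hd, hd', Matrix.diagonal_mul_diagonal]⟩

lemma splitting_swap_eq_zero (hΦσ : ∀ x, Φ (1 ⊗ₜ σ x) = swapAdj E m (Φ (1 ⊗ₜ x)))
    (hΦT : ∀ x, algebraMap F E (T x) = Matrix.trace (Φ (1 ⊗ₜ x)))
    {v : Fin m ⊕ Fin m → E} (hu : Φ (1 ⊗ₜ u) = Matrix.diagonal v)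
    (hℓ' : ℓ' ∈ Algebra.adjoin F {u}) (hℓ : ∀ s, σ s = s → T (ℓ * s) = T (ℓ' * s))
    (p : Fin m ⊕ Fin m) : Φ (1 ⊗ₜ ℓ) p.swap p = 0 := by
  obtain ⟨d, hd⟩ := splitting_adjoin_eq_diagonal hu hℓ'
  have h := trace_splitting_mul_eq (Y := Matrix.single p p.swap 1) hΦσ hΦT hℓ
    (by rw [swapAdj_single, Sum.swap_swap])
  rw [Matrix.trace_mul_single, Matrix.trace_mul_single, hd,
    Matrix.diagonal_apply_ne _ (by cases p <;> simp)] at h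
  simpa using h

lemma forall_cliffLin_mul_eq_iff {v : Fin m ⊕ Fin m → E} (hu : Φ (1 ⊗ₜ u) = Matrix.diagonal v)
    (s : E) (X : E ⊗[F] CliffordAlg F A T σ ℓ) :
    (∀ y, (1 ⊗ₜ cliffLin F A T σ ℓ (y * u)) * X = s • ((1 ⊗ₜ cliffLin F A T σ ℓ y) * X)) ↔
      ∀ p q, (v (Sum.swap q) - s) • (cliffCoeff T σ ℓ Φ p q * X) = 0 := by
  have h1 : ∀ y, (1 : E) ⊗ₜ[F] cliffLin F A T σ ℓ (y * u) =
      splitCliff T σ ℓ Φ (Φ (1 ⊗ₜ y) * Matrix.diagonal v) := fun y => by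
    rw [← hu, ← map_mul, Algebra.TensorProduct.tmul_mul_tmul, mul_one, splitCliff_apply]
  have h2 : ∀ p q, splitCliff T σ ℓ Φ (Matrix.single p q.swap 1 * Matrix.diagonal v) =
      v q.swap • cliffCoeff T σ ℓ Φ p q := fun p q => by
    rw [← splitCliff_single]
    congr 1
    ext i j
    rw [Matrix.mul_diagonal, Matrix.single_apply, Matrix.single_apply]
    split_ifs with h
    · rw [h.2, one_mul]
    · rw [zero_mul]
  simp only [h1, ← splitCliff_apply (E := E) (Φ := Φ)]
  constructor
  · intro H p q
    have key : ∀ Y, splitCliff T σ ℓ Φ (Y * Matrix.diagonal v) * X =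
        s • (splitCliff T σ ℓ Φ Y * X) := by
      intro Y
      induction Y using splitting_induction (Φ := Φ) with
      | hsmul e x => simp only [smul_mul_assoc, map_smul, H, smul_comm s e]
      | hadd X Y hX hY => simp only [add_mul, map_add, hX, hY, smul_add]
    have := key (Matrix.single p q.swap 1)
    rw [h2, smul_mul_assoc, ← sub_eq_zero] at this
    rw [sub_smul]
    exact this
  · intro H y
    generalize Φ (1 ⊗ₜ y) = Y
    rw [splitCliff_eq_sum, splitCliff_eq_sum]
    simp only [Matrix.mul_diagonal, Finset.sum_mul, Finset.smul_sum, smul_mul_assoc]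
    refine Finset.sum_congr rfl fun p _ => Finset.sum_congr rfl fun q _ => ?_
    rw [← sub_eq_zero, smul_smul, ← sub_smul, mul_comm s, ← mul_sub, mul_smul, H, smul_zero]

end Final

end Triality

end

namespace Triality

/-- Remark 3.8 of the paper.  Let `(A, σ, f)` be an `F`-algebra with
quadratic pair which is a quadratic extension of an `F`-algebra with `K/F`-unitary
involution `(C, σ_C)`, and assume `C` has odd degree (so `deg A ≡ 2 mod 4`).  Then the
discriminant of `(σ, f)` coincides with the class defining the étale quadratic
`F`-algebra `K`, i.e. the centre of the Clifford algebra of `(A, σ, f)` is isomorphic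
to `K` as an `F`-algebra. -/
theorem discriminant_of_quad_ext_odd_degree (F : Type) [Field F]
    -- the étale quadratic F-algebra K = F[u] with automorphism ι
    (K : Type) [CommRing K] [Algebra F K] (hK2 : Module.finrank F K = 2)
    (u : K) (a : F) (hu : u * u = u + algebraMap F K a)
    (hugen : u ∉ Set.range (algebraMap F K)) (ha : (1 : F) + 4 * a ≠ 0)
    (ι : K ≃ₐ[F] K) (hι : ι u = 1 - u)
    -- the K-algebra with K/F-unitary involution (C, σ_C), of odd degree over K
    (C : Type) [Ring C] [Algebra F C] [Algebra K C] [IsScalarTower F K C]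
    (hCfin : Module.Finite F C) (hCss : IsSemisimpleRing C)
    (hCcentral : Algebra.IsCentral K C)
    (σC : C →ₗ[F] C) (hσC : IsInvolution F σC)
    (hunitary : ∀ x : K, σC (algebraMap K C x) = algebraMap K C (ι x))
    (hodd : Odd (deg K C))
    -- the F-algebra with quadratic pair (A, σ, f), a quadratic extension of (C, σ_C)
    (A : Type) [Ring A] [Algebra F A] (hA : IsCSA F A)
    (T : A →ₗ[F] F) (hT : IsReducedTrace F A T)
    (σ : A →ₗ[F] A) (ℓ : A) (hqp : IsQuadraticPair F A T σ ℓ)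
    (hext : IsQPQuadExt F A T σ ℓ C σC (algebraMap K C u)) :
    Nonempty ((Subalgebra.center F (CliffordAlg F A T σ ℓ)) ≃ₐ[F] K) := by
  obtain ⟨j, hj, hjσ, hrange, ℓK, hℓK, -, -, hℓℓK⟩ := hext
  obtain ⟨hσ, hdim, -, hℓ⟩ := hqp
  have := hA.2.2
  have huC : j (algebraMap K C u) * j (algebraMap K C u) =
      j (algebraMap K C u) + algebraMap F A a := by
    rw [← map_mul, ← map_mul, hu, map_add, map_add, ← IsScalarTower.algebraMap_apply,
      AlgHom.commutes]
  have hσu : σ (j (algebraMap K C u)) = 1 - j (algebraMap K C u) := by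
    rw [hjσ, hunitary, hι, map_sub, map_sub, map_one, map_one]
  obtain ⟨E, _, _, r, m, Φ, hr, hΦσ', hΦT, hΦu⟩ := exists_frame hA hT hσ hdim huC hσu ha
  have hΦσ : ∀ x, Φ (1 ⊗ₜ σ x) = swapAdj E m (Φ (1 ⊗ₜ x)) := fun x => by ext; exact hΦσ' x _ _
  have hr2 := two_mul_sub_one_ne_zero ha hr
  have hm : Odd m := by
    have h1 := finrank_centralizer_eq (fun h => hr2 (by linear_combination h)) Φ hΦu
    have h2 : LinearMap.range j.toLinearMap = LinearMap.ker
        (LinearMap.mulLeft F (j (algebraMap K C u)) -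
          LinearMap.mulRight F (j (algebraMap K C u))) := by
      ext x
      have := Set.ext_iff.1 hrange x
      simp only [Set.mem_centralizer_iff, Set.mem_singleton_iff, forall_eq] at this
      rw [LinearMap.mem_ker, LinearMap.sub_apply, LinearMap.mulLeft_apply,
        LinearMap.mulRight_apply, sub_eq_zero]
      exact this
    rw [← h2, LinearMap.finrank_range_of_inj hj,
      finrank_eq_two_mul_finrank_of_unitary hK2 hugen hu ha hι hσC hunitary] at h1
    rwa [deg, Nat.eq_of_mul_eq_mul_left two_pos h1, Nat.sqrt_eq] at hodd
  have hL := splitting_add_swap hΦσ hℓ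
  have hL0 := splitting_swap_eq_zero hΦσ hΦT hΦu hℓK hℓℓK
  obtain ⟨ρ, hρ⟩ := (fockModel E m).exists_algHom hΦσ hΦT hL hL0
  obtain ⟨z, hz, hspan, h₁, ⟨X₁, hX₁, hX₁'⟩, h₀, ⟨X₀, hX₀, hX₀'⟩⟩ :=
    (isEvenCliffordSystem_cliffCoeff hΦσ hΦT hL hL0).exists_central_idempotent _ hm ρ hρ
  have hiff := forall_cliffLin_mul_eq_iff (T := T) (σ := σ) (ℓ := ℓ) hΦu
  obtain ⟨w, hw, hww, hwspan, hwne⟩ := exists_center_generator hr hr2 (cliffLin F A T σ ℓ)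
    (fun y => cliffLin F A T σ ℓ (y * j (algebraMap K C u))) z hz hspan
    (fun X hX => h₁ X fun p i => by
      have := (hiff _ _).1 hX p (Sum.inr i)
      refine (smul_eq_zero.1 this).resolve_left fun h => hr2 ?_
      simp only [Sum.swap_inr, Sum.elim_inl] at h
      linear_combination h)
    ⟨X₁, hX₁, (hiff _ _).2 fun p q => by
      rcases q with i | i
      · simp
      · rw [hX₁', smul_zero]⟩
    (fun X hX => h₀ X fun p i => by
      have := (hiff _ _).1 hX p (Sum.inl i)
      refine (smul_eq_zero.1 this).resolve_left fun h => hr2 ?_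
      simp only [Sum.swap_inl, Sum.elim_inr] at h
      linear_combination -h)
    ⟨X₀, hX₀, (hiff _ _).2 fun p q => by
      rcases q with i | i
      · rw [hX₀', smul_zero]
      · simp⟩
  obtain ⟨e⟩ := nonempty_quadraticAlgebra_algEquiv (S := K) (a := a) (u := u)
    (by rw [hu, Algebra.algebraMap_eq_smul_one])
    (exists_eq_smul_one_add_smul hK2 hugen)
    (fun α h => hugen ⟨α, by rw [h, Algebra.algebraMap_eq_smul_one]⟩)
  obtain ⟨e'⟩ := nonempty_quadraticAlgebra_algEquiv
    (S := Subalgebra.center F (CliffordAlg F A T σ ℓ)) (a := a)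
    (u := ⟨w, Subalgebra.mem_center_iff.2 fun b => (hw b).symm⟩)
    (Subtype.ext hww)
    (fun s => by
      obtain ⟨α, β, h⟩ := hwspan s fun b => (Subalgebra.mem_center_iff.1 s.2 b).symm
      exact ⟨α, β, Subtype.ext h⟩)
    (fun α h => hwne α (congrArg Subtype.val h))
  exact ⟨e'.symm.trans e⟩

end Triality
end
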